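/- arXiv:2102.09684 — 15 statements merged into one kernel-verified Lean document; each statement's English description precedes it below -/
import Mathlib

section
/- Let p be a prime and let i, j, k be integers with k ≥ 0, j ≥ i, and p^k ≤ i < p^{k+1}. Then v_p(C(j, i)) ≥ v_p(C(j, p^k)), where C(j, i) denotes the binomial coefficient and v_p the p-adic valuation. -/
/-- Adding `a` and `n - a` in base `M` carries out of the last digit iff the last digit of `n` is
smaller than that of `a`. -/
theorem le_mod_add_sub_mod_iff {M a n : ℕ} (hM : 0 < M) (ha : a ≤ n) :
    M ≤ a % M + (n - a) % M ↔ n % M < a % M := by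
  have h := Nat.add_mod_add_ite a (n - a) M
  rw [Nat.add_sub_cancel' ha] at h
  have := Nat.mod_lt a hM
  have := Nat.mod_lt (n - a) hM
  have := Nat.mod_lt n hM
  split_ifs at h <;> omega

/-- Kummer-type monotonicity of `p`-adic valuations of binomial coefficients:
if `p^k ≤ i < p^(k+1)` and `i ≤ j`, then `v_p (C(j, p^k)) ≤ v_p (C(j, i))`. -/
theorem stmt_0 (p : ℕ) (hp : p.Prime) (i j k : ℕ) (hji : i ≤ j)
    (h1 : p ^ k ≤ i) (h2 : i < p ^ (k + 1)) :
    padicValNat p (j.choose (p ^ k)) ≤ padicValNat p (j.choose i) := by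
  have : Fact p.Prime := ⟨hp⟩
  rw [padicValNat_choose (h1.trans hji) (Nat.lt_succ_self _),
    padicValNat_choose hji (Nat.lt_succ_self _)]
  refine Finset.card_le_card fun m hm => ?_
  have hpos : 0 < p ^ m := pow_pos hp.pos m
  rw [Finset.mem_filter, le_mod_add_sub_mod_iff hpos (h1.trans hji)] at hm
  rw [Finset.mem_filter, le_mod_add_sub_mod_iff hpos hji]
  refine ⟨hm.1, ?_⟩
  rcases le_or_gt m k with hmk | hkm
  · exact absurd hm.2 (by simp [Nat.mod_eq_zero_of_dvd (pow_dvd_pow p hmk)])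
  · rw [Nat.mod_eq_of_lt (h2.trans_le (Nat.pow_le_pow_right hp.pos hkm))]
    exact (hm.2.trans_le (Nat.mod_le _ _)).trans_le h1
end

section
/- Let p be a prime and let j, k be integers with k ≥ 0 and j ≥ p^{k+1}. Then v_p(C(j, p^{k+1})) ≥ v_p(C(j, p^k)) − 1, and equality v_p(C(j, p^{k+1})) = v_p(C(j, p^k)) − 1 holds if and only if v_p(C(j, p^k)) ≠ 0. -/
/-- Adding `q` and `n` modulo `q * P` carries exactly when `P` divides `n / q + 1`. For `q = p ^ k`
and `P = p ^ t` this describes the carry at position `k + t` in base `p`. -/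
theorem Nat.mul_le_mod_add_mod_iff_dvd {q P : ℕ} (hq : 0 < q) (hP : 1 < P) (n : ℕ) :
    q * P ≤ q % (q * P) + n % (q * P) ↔ P ∣ n / q + 1 := by
  have hx : n / q % P < P := Nat.mod_lt _ (by omega)
  have hr : n % q < q := Nat.mod_lt _ hq
  have hdvd : P ∣ n / q + 1 ↔ P ≤ n / q % P + 1 := by
    rw [← Nat.mod_add_div (n / q) P, add_right_comm, Nat.dvd_add_left (dvd_mul_right _ _),
      Nat.add_mul_mod_self_left, Nat.mod_mod]
    exact ⟨Nat.le_of_dvd (by omega), fun h => by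
      rw [show n / q % P + 1 = P by omega]⟩
  rw [hdvd, Nat.mod_eq_of_lt (by nlinarith : q < q * P), Nat.mod_mul]
  constructor
  · intro h
    by_contra! hlt
    nlinarith
  · intro h
    calc q * P ≤ q * (n / q % P + 1) := Nat.mul_le_mul_left q h
      _ ≤ _ := by linarith [Nat.zero_le (n % q)]

/-- The `p`-adic valuation of `j.choose (p ^ k)` is that of `j / p ^ k`. -/
theorem padicValNat_choose_prime_pow_eq_div {p : ℕ} [hp : Fact p.Prime] {j k : ℕ}
    (hj : p ^ k ≤ j) : padicValNat p (j.choose (p ^ k)) = padicValNat p (j / p ^ k) := by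
  have hq : 0 < p ^ k := pow_pos hp.out.pos k
  have hdiv : j / p ^ k = (j - p ^ k) / p ^ k + 1 := Nat.div_eq_sub_div hq hj
  have hlt : j / p ^ k < p ^ (Nat.log p j + 1) :=
    (Nat.div_le_self _ _).trans_lt (Nat.lt_pow_succ_log_self hp.out.one_lt j)
  rw [padicValNat_choose hj (b := Nat.log p j + 1 + k) (by omega),
    ← Nat.factorization_def _ hp.out,
    Nat.factorization_eq_card_pow_dvd_of_lt hp.out (Nat.div_pos hj hq) hlt,
    ← Finset.card_map (addRightEmbedding k)
      (s := {i ∈ Finset.Ico 1 (Nat.log p j + 1) | p ^ i ∣ j / p ^ k})]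
  congr 1
  ext i
  simp only [Finset.mem_filter, Finset.mem_Ico, Finset.mem_map, addRightEmbedding_apply]
  have hcarry : ∀ t, 1 ≤ t → (p ^ (t + k) ≤ p ^ k % p ^ (t + k) + (j - p ^ k) % p ^ (t + k) ↔
      p ^ t ∣ j / p ^ k) := fun t ht => by
    rw [hdiv, add_comm t k, pow_add]
    exact Nat.mul_le_mod_add_mod_iff_dvd hq (Nat.one_lt_pow (by omega) hp.out.one_lt) _
  constructor
  · rintro ⟨hi, h⟩
    by_cases hik : i ≤ k
    · rw [Nat.mod_eq_zero_of_dvd (pow_dvd_pow p hik), zero_add] at h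
      exact absurd h (Nat.mod_lt _ (pow_pos hp.out.pos i)).not_ge
    · obtain ⟨t, rfl⟩ := Nat.exists_eq_add_of_le' (not_le.mp hik).le
      exact ⟨t, ⟨by omega, (hcarry t (by omega)).mp h⟩, rfl⟩
  · rintro ⟨t, ⟨ht, h⟩, rfl⟩
    exact ⟨by omega, (hcarry t ht.1).mpr h⟩

/-- If `j ≥ p^(k+1)`, then `v_p (C(j, p^(k+1))) ≥ v_p (C(j, p^k)) - 1`, with equality
iff `v_p (C(j, p^k)) ≠ 0`. -/
theorem stmt_1 (p : ℕ) (hp : p.Prime) (j k : ℕ) (hj : p ^ (k + 1) ≤ j) :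
    (padicValNat p (j.choose (p ^ k)) : ℤ) - 1 ≤
      (padicValNat p (j.choose (p ^ (k + 1))) : ℤ) ∧
    ((padicValNat p (j.choose (p ^ (k + 1))) : ℤ) =
        (padicValNat p (j.choose (p ^ k)) : ℤ) - 1 ↔
      padicValNat p (j.choose (p ^ k)) ≠ 0) := by
  have : Fact p.Prime := ⟨hp⟩
  have hjk : p ^ k ≤ j := (Nat.pow_le_pow_right hp.pos k.le_succ).trans hj
  rw [padicValNat_choose_prime_pow_eq_div hj, padicValNat_choose_prime_pow_eq_div hjk,
    pow_succ, ← Nat.div_div_eq_div_mul]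
  have hm : j / p ^ k ≠ 0 := (Nat.div_pos hjk (pow_pos hp.pos k)).ne'
  by_cases hdvd : p ∣ j / p ^ k
  · have h1 := one_le_padicValNat_of_dvd hm hdvd
    rw [padicValNat.div hdvd]
    omega
  · rw [padicValNat.eq_zero_of_not_dvd hdvd]
    omega
end

section
/- Let m, m', m'' be nonnegative integers, let e, e', e'' be integers with 0 ≤ e, e', e'' ≤ q − 1, let s, t, u be integers with 0 ≤ s < t < u ≤ r, let C be a real number with |C| ≤ 1, and let n ≥ 2 be an integer. Then the inequality m' + e'·C/q^n < ((p^t − p^s)/(p^u − p^s))·(m + e·C/q^n) + ((p^u − p^t)/(p^u − p^s))·(m'' + e''·C/q^n) holds if and only if the same inequality holds with n replaced by n + 1. (Geometrically: the point (p^t, m' + e'C/q^n) lies strictly below the line through (p^s, m + eC/q^n) and (p^u, m'' + e''C/q^n) if and only if the analogous statement holds with n replaced by n + 1.) -/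
/-- Adding a real number of absolute value less than `1` to an integer changes the sign only if
the integer is `0`. -/
theorem intCast_add_pos_iff (M : ℤ) {x : ℝ} (hx : |x| < 1) :
    0 < (M : ℝ) + x ↔ 0 < M ∨ M = 0 ∧ 0 < x := by
  obtain ⟨h₁, h₂⟩ := abs_lt.mp hx
  rcases lt_trichotomy M 0 with hM | rfl | hM
  · have : (M : ℝ) ≤ -1 := by exact_mod_cast (by omega : M ≤ -1)
    exact iff_of_false (by linarith) (by omega)
  · simp
  · have : (1 : ℝ) ≤ M := by exact_mod_cast hM
    exact iff_of_true (by linarith) (Or.inl hM)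

/-- The sign of `M + E * (C / q ^ n)` does not depend on `n ≥ 2` when `|E| < q ^ 2`
and `|C| ≤ 1`. -/
theorem intCast_add_mul_div_pow_pos_iff_succ (M E : ℤ) {q : ℝ} (hq : 1 ≤ q)
    (hE : |(E : ℝ)| < q ^ 2) {C : ℝ} (hC : |C| ≤ 1) {n : ℕ} (hn : 2 ≤ n) :
    0 < (M : ℝ) + E * (C / q ^ n) ↔ 0 < (M : ℝ) + E * (C / q ^ (n + 1)) := by
  have hq0 : 0 < q := by linarith
  have hsmall : ∀ k : ℕ, 2 ≤ k → |(E : ℝ) * (C / q ^ k)| < 1 := by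
    intro k hk
    have hpow : q ^ 2 ≤ q ^ k := pow_le_pow_right₀ hq hk
    rw [abs_mul, abs_div, abs_of_pos (pow_pos hq0 k), ← mul_div_assoc, div_lt_one (pow_pos hq0 k)]
    calc |(E : ℝ)| * |C| ≤ |(E : ℝ)| := mul_le_of_le_one_right (abs_nonneg _) hC
      _ < q ^ k := hE.trans_le hpow
  have hscale : (E : ℝ) * (C / q ^ n) = E * (C / q ^ (n + 1)) * q := by
    rw [pow_succ]; field_simp
  rw [intCast_add_pos_iff M (hsmall n hn), intCast_add_pos_iff M (hsmall (n + 1) (by omega)),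
    hscale, mul_pos_iff_of_pos_right hq0]

/-- A difference of a weighted sum with total weight `A + B` and `A + B` times a number is bounded
by the total weight times the length of the interval containing the numbers. -/
theorem abs_weighted_sub_le {A B k e e' e'' : ℝ} (hA : 0 ≤ A) (hB : 0 ≤ B)
    (h0 : 0 ≤ e) (h0' : 0 ≤ e') (h0'' : 0 ≤ e'') (hk : e ≤ k) (hk' : e' ≤ k) (hk'' : e'' ≤ k) :
    |A * e + B * e'' - (A + B) * e'| ≤ (A + B) * k := by
  have hle : |A * (e - e') + B * (e'' - e')| ≤ A * k + B * k := by
    refine (abs_add_le _ _).trans (add_le_add ?_ ?_)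
    · rw [abs_mul, abs_of_nonneg hA]
      exact mul_le_mul_of_nonneg_left (abs_le.mpr ⟨by linarith, by linarith⟩) hA
    · rw [abs_mul, abs_of_nonneg hB]
      exact mul_le_mul_of_nonneg_left (abs_le.mpr ⟨by linarith, by linarith⟩) hB
  convert hle using 1
  · congr 1; ring
  · ring


/-- The point `(p^t, m' + e' C/q^n)` lies strictly below the line through
`(p^s, m + e C/q^n)` and `(p^u, m'' + e'' C/q^n)` iff the same holds with `n + 1`
in place of `n`. -/
theorem stmt_2 (p r : ℕ) (hp : p.Prime) (hr : 1 ≤ r) (q : ℕ) (hq : q = p ^ r)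
    (m m' m'' : ℕ) (e e' e'' : ℕ) (he : e ≤ q - 1) (he' : e' ≤ q - 1) (he'' : e'' ≤ q - 1)
    (s t u : ℕ) (hst : s < t) (htu : t < u) (hur : u ≤ r)
    (C : ℝ) (hC : |C| ≤ 1) (n : ℕ) (hn : 2 ≤ n) :
    ((m' : ℝ) + (e' : ℝ) * (C / (q : ℝ) ^ n) <
        (((p : ℝ) ^ t - (p : ℝ) ^ s) / ((p : ℝ) ^ u - (p : ℝ) ^ s)) *
          ((m : ℝ) + (e : ℝ) * (C / (q : ℝ) ^ n)) +
        (((p : ℝ) ^ u - (p : ℝ) ^ t) / ((p : ℝ) ^ u - (p : ℝ) ^ s)) *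
          ((m'' : ℝ) + (e'' : ℝ) * (C / (q : ℝ) ^ n))) ↔
    ((m' : ℝ) + (e' : ℝ) * (C / (q : ℝ) ^ (n + 1)) <
        (((p : ℝ) ^ t - (p : ℝ) ^ s) / ((p : ℝ) ^ u - (p : ℝ) ^ s)) *
          ((m : ℝ) + (e : ℝ) * (C / (q : ℝ) ^ (n + 1))) +
        (((p : ℝ) ^ u - (p : ℝ) ^ t) / ((p : ℝ) ^ u - (p : ℝ) ^ s)) *
          ((m'' : ℝ) + (e'' : ℝ) * (C / (q : ℝ) ^ (n + 1)))) := by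
  obtain ⟨i, rfl⟩ := Nat.exists_eq_add_of_lt hst
  obtain ⟨j, rfl⟩ := Nat.exists_eq_add_of_lt htu
  have hp1 : (1 : ℝ) < p := by exact_mod_cast hp.one_lt
  have hp0 : (0 : ℝ) < p := by linarith
  have hq0 : 0 < q := hq ▸ pow_pos hp.pos r
  have hq1 : (1 : ℝ) ≤ q := by exact_mod_cast hq0
  have hcast : ∀ a : ℕ, a ≤ q - 1 → (a : ℝ) ≤ q - 1 := by
    intro a ha
    have : ((a + 1 : ℕ) : ℝ) ≤ q := by exact_mod_cast (by omega : a + 1 ≤ q)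
    push_cast at this
    linarith
  have hA : (1 : ℝ) < (p : ℝ) ^ (i + 1) := one_lt_pow₀ hp1 (by omega)
  have hB : (p : ℝ) ^ (i + 1) < (p : ℝ) ^ (i + 1 + (j + 1)) :=
    pow_lt_pow_right₀ hp1 (by omega)
  have hD : (p : ℝ) ^ (i + 1 + (j + 1)) ≤ q := by
    rw [hq, Nat.cast_pow]
    exact pow_le_pow_right₀ hp1.le (by omega)
  set A : ℤ := (p : ℤ) ^ (i + 1) - 1 with hAdef
  set B : ℤ := (p : ℤ) ^ (i + 1 + (j + 1)) - (p : ℤ) ^ (i + 1) with hBdef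
  have hAr : (A : ℝ) = (p : ℝ) ^ (i + 1) - 1 := by rw [hAdef]; push_cast; ring
  have hBr : (B : ℝ) = (p : ℝ) ^ (i + 1 + (j + 1)) - (p : ℝ) ^ (i + 1) := by
    rw [hBdef]; push_cast; ring
  have hA0 : (0 : ℝ) < A := by linarith
  have hB0 : (0 : ℝ) < B := by linarith
  have hs : (0 : ℝ) < (p : ℝ) ^ s := pow_pos hp0 s
  have hts : (p : ℝ) ^ (s + i + 1) - (p : ℝ) ^ s = (p : ℝ) ^ s * A := by rw [hAr]; ring
  have hut : (p : ℝ) ^ (s + i + 1 + j + 1) - (p : ℝ) ^ (s + i + 1) = (p : ℝ) ^ s * B := by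
    rw [hBr]; ring
  have hus : (p : ℝ) ^ (s + i + 1 + j + 1) - (p : ℝ) ^ s = (p : ℝ) ^ s * (A + B) := by
    rw [hAr, hBr]; ring
  have key : ∀ x : ℝ,
      ((m' : ℝ) + e' * x < (p : ℝ) ^ s * A / ((p : ℝ) ^ s * (A + B)) * (m + e * x) +
        (p : ℝ) ^ s * B / ((p : ℝ) ^ s * (A + B)) * (m'' + e'' * x)) ↔
      0 < ((A * m + B * m'' - (A + B) * m' : ℤ) : ℝ) +
        ((A * e + B * e'' - (A + B) * e' : ℤ) : ℝ) * x := by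
    intro x
    have hAB : (0 : ℝ) < A + B := by linarith
    rw [mul_div_mul_left _ _ hs.ne', mul_div_mul_left _ _ hs.ne', div_mul_eq_mul_div,
      div_mul_eq_mul_div, ← add_div, lt_div_iff₀ hAB, ← sub_pos]
    push_cast
    ring_nf
  have hE : |((A * e + B * e'' - (A + B) * e' : ℤ) : ℝ)| < (q : ℝ) ^ 2 := by
    push_cast
    refine (abs_weighted_sub_le hA0.le hB0.le e.cast_nonneg e'.cast_nonneg e''.cast_nonneg
      (hcast e he) (hcast e' he') (hcast e'' he'')).trans_lt ?_
    have hABq : (A : ℝ) + B ≤ q - 1 := by linarith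
    nlinarith [mul_le_mul_of_nonneg_right hABq (sub_nonneg.mpr hq1)]
  rw [hts, hut, hus, key, key]
  exact intCast_add_mul_div_pow_pos_iff_succ _ _ hq1 hE hC hn
end

section
/- Suppose v(P_i) ≥ 1 for all 1 ≤ i ≤ q − 1. Let c ∈ L with v(c) > 0 and c ≠ 0, and let β ∈ L satisfy P(β) = c. Then v(β) ≤ max{ v(c) − 1, v(c)/2 }. -/
theorem le_map_sum_of_min_le_map_add {ι M Γ : Type*} [AddCommMonoid M] [LinearOrder Γ] [OrderTop Γ]
    {v : M → Γ} (hzero : v 0 = ⊤) (hadd : ∀ x y : M, min (v x) (v y) ≤ v (x + y))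
    {m : Γ} {s : Finset ι} {f : ι → M} (h : ∀ i ∈ s, m ≤ v (f i)) :
    m ≤ v (∑ i ∈ s, f i) :=
  Finset.sum_induction f (fun x => m ≤ v x) (fun x y hx hy => (le_min hx hy).trans (hadd x y))
    (by simp [hzero]) h

theorem succ_mul_le_map_pow_succ {M : Type*} [Monoid M] {v : M → WithTop ℝ}
    (hmul : ∀ x y : M, v (x * y) = v x + v y) {x : M} {b : ℝ} (hx : (b : WithTop ℝ) ≤ v x)
    (n : ℕ) : ((((n : ℝ) + 1) * b : ℝ) : WithTop ℝ) ≤ v (x ^ (n + 1)) := by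
  induction n with
  | zero => simpa using hx
  | succ n ih =>
    rw [pow_succ, hmul, show ((n + 1 : ℕ) : ℝ) + 1 = (n : ℝ) + 1 + 1 by push_cast; ring,
      add_mul ((n : ℝ) + 1) 1 b, one_mul, WithTop.coe_add]
    exact add_le_add ih hx


/-- If all non-leading, non-constant coefficients of the monic degree-`q` polynomial `P`
(with `P(0) = 0`) have valuation at least `1`, `c ≠ 0` and `v(c) > 0`, then any root `β` of
`P(X) = c` satisfies `v(β) ≤ max (v(c) - 1) (v(c)/2)`. -/
theorem stmt_5 (p r : ℕ) (hp : p.Prime) (hr : 1 ≤ r) (q : ℕ) (hq : q = p ^ r)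
    (L : Type) [Field L] [CharZero L]
    (v : L → WithTop ℝ)
    (hv0 : ∀ x : L, v x = ⊤ ↔ x = 0)
    (hvmul : ∀ x y : L, v (x * y) = v x + v y)
    (hvadd : ∀ x y : L, min (v x) (v y) ≤ v (x + y))
    (P : Polynomial L) (hmonic : P.Monic) (hdeg : P.natDegree = q)
    (hP0 : P.coeff 0 = 0)
    (hPint : ∀ i, 1 ≤ i → i ≤ q - 1 → (1 : WithTop ℝ) ≤ v (P.coeff i))
    (c : L) (hc : c ≠ 0) (vc : ℝ) (hvc : v c = (vc : WithTop ℝ)) (hvc0 : 0 < vc)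
    (β : L) (hβ : P.eval β = c) :
    v β ≤ ((max (vc - 1) (vc / 2) : ℝ) : WithTop ℝ) := by
  have hq2 : 2 ≤ q := hq ▸ hp.two_le.trans (Nat.le_self_pow (by omega) p)
  have hβ0 : β ≠ 0 := by
    rintro rfl
    exact hc (by rw [← hβ, ← Polynomial.coeff_zero_eq_eval_zero, hP0])
  obtain ⟨b, hb⟩ := WithTop.ne_top_iff_exists.mp (mt (hv0 β).mp hβ0)
  rw [← hb, WithTop.coe_le_coe]
  by_contra! hlt
  obtain ⟨h1, h2⟩ := max_lt_iff.mp hlt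
  have hb0 : 0 < b := by linarith
  have key : ((min (1 + b) (2 * b) : ℝ) : WithTop ℝ) ≤ v c := by
    rw [← hβ, Polynomial.eval_eq_sum_range]
    refine le_map_sum_of_min_le_map_add ((hv0 0).mpr rfl) hvadd fun i hi => ?_
    rw [Finset.mem_range, hdeg] at hi
    obtain _ | n := i
    · rw [hP0, zero_mul, (hv0 0).mpr rfl]
      exact le_top
    have hpow := succ_mul_le_map_pow_succ hvmul hb.le n
    have hn : (0 : ℝ) ≤ n := n.cast_nonneg
    obtain hnq | hnq := (Nat.lt_succ_iff.mp hi).eq_or_lt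
    · rw [show P.coeff (n + 1) = 1 by rw [hnq, ← hdeg]; exact hmonic.coeff_natDegree, one_mul]
      refine le_trans (WithTop.coe_le_coe.mpr ?_) hpow
      have hn1 : (1 : ℝ) ≤ n := by exact_mod_cast (by omega : 1 ≤ n)
      exact (min_le_right _ _).trans (by nlinarith)
    · rw [hvmul]
      refine le_trans ?_ (add_le_add (hPint (n + 1) (by omega) (by omega)) hpow)
      rw [← WithTop.coe_one, ← WithTop.coe_add, WithTop.coe_le_coe]
      exact (min_le_left _ _).trans (by nlinarith)
  rw [hvc, WithTop.coe_le_coe] at key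
  exact absurd key (not_le.mpr (lt_min (by linarith) (by linarith)))
end

section
/- Suppose v(P_i) ≥ 1 for all 1 ≤ i ≤ q − 1. Let β ∈ L with P(β) ≠ 0. Then v(P(β)) > 0 if and only if v(β) > 0, v(P(β)) = 0 if and only if v(β) = 0, and v(P(β)) < 0 if and only if v(β) < 0. In particular, for any sequence (α_n) in L with P(α_n) = α_{n−1} for all n ≥ 1 and v(α_0) ∉ {0, ∞}, the valuation v(α_n) has the same sign as v(α_0) for every n. -/
namespace AddValuation

variable {L : Type*} [CommRing L] (w : AddValuation L (WithTop ℝ)) {P : Polynomial L}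

/-- If all lower coefficients of a monic nonconstant polynomial have positive valuation,
then it maps elements of positive valuation to elements of positive valuation. -/
theorem eval_pos_of_coeff_pos (hP : P.Monic) (hdeg : P.natDegree ≠ 0)
    (h : ∀ i < P.natDegree, 0 < w (P.coeff i)) {β : L} (hβ : 0 < w β) :
    0 < w (P.eval β) := by
  rw [Polynomial.eval_eq_sum_range]
  refine w.map_lt_sum (by simp) fun i hi => ?_
  rw [w.map_mul, w.map_pow]
  rcases (Finset.mem_range_succ_iff.mp hi).lt_or_eq with hlt | rfl
  · exact add_pos_of_pos_of_nonneg (h i hlt) (nsmul_nonneg hβ.le i)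
  · rw [hP.coeff_natDegree, w.map_one, zero_add]
    exact nsmul_pos hβ hdeg

/-- If all lower coefficients of a monic polynomial have positive valuation, then at an element
of nonpositive valuation the leading term dominates. -/
theorem eval_eq_nsmul_of_coeff_pos (hP : P.Monic)
    (h : ∀ i < P.natDegree, 0 < w (P.coeff i)) {β : L} (hβ : w β ≤ 0) :
    w (P.eval β) = P.natDegree • w β := by
  rw [Polynomial.eval_eq_sum_range, Finset.sum_range_succ, hP.coeff_natDegree, one_mul,
    ← w.map_pow]
  refine w.map_add_eq_of_lt_right ?_
  rw [w.map_pow]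
  obtain ⟨b, hb⟩ := WithTop.ne_top_iff_exists.mp (hβ.trans_lt (WithTop.coe_lt_top 0)).ne
  have hb0 : b ≤ 0 := by rw [← hb] at hβ; exact_mod_cast hβ
  refine w.map_lt_sum (by rw [← hb, ← WithTop.coe_nsmul]; exact WithTop.coe_ne_top) fun i hi => ?_
  have hlt := Finset.mem_range.mp hi
  rw [w.map_mul, w.map_pow, ← hb, ← WithTop.coe_nsmul, ← WithTop.coe_nsmul]
  have hpos := h i hlt
  induction hc : w (P.coeff i) with
  | top => rw [WithTop.top_add]; exact WithTop.coe_lt_top _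
  | coe c =>
    rw [hc] at hpos
    have hc0 : 0 < c := by exact_mod_cast hpos
    rw [← WithTop.coe_add, WithTop.coe_lt_coe, nsmul_eq_mul, nsmul_eq_mul]
    have hle : (i : ℝ) ≤ P.natDegree := by exact_mod_cast hlt.le
    nlinarith

/-- If all lower coefficients of a monic nonconstant polynomial have positive valuation,
then evaluation preserves the sign of the valuation. -/
theorem eval_sign_iff (hP : P.Monic) (hdeg : P.natDegree ≠ 0)
    (h : ∀ i < P.natDegree, 0 < w (P.coeff i)) (β : L) :
    (0 < w (P.eval β) ↔ 0 < w β) ∧ (w (P.eval β) = 0 ↔ w β = 0) ∧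
      (w (P.eval β) < 0 ↔ w β < 0) := by
  rcases lt_trichotomy (w β) 0 with hβ | hβ | hβ
  · have hlt : w (P.eval β) < 0 := by
      rw [w.eval_eq_nsmul_of_coeff_pos hP h hβ.le]
      obtain ⟨b, hb⟩ := WithTop.ne_top_iff_exists.mp (hβ.trans (WithTop.coe_lt_top 0)).ne
      rw [← hb] at hβ ⊢
      have hb0 : b < 0 := by exact_mod_cast hβ
      exact_mod_cast nsmul_neg hb0 hdeg
    simp [hβ, hlt, hβ.ne, hlt.ne, hβ.not_gt, hlt.not_gt]
  · have heq : w (P.eval β) = 0 := by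
      rw [w.eval_eq_nsmul_of_coeff_pos hP h hβ.le, hβ, nsmul_zero]
    simp [hβ, heq]
  · have hpos := w.eval_pos_of_coeff_pos hP hdeg h hβ
    simp [hβ, hpos, hβ.ne', hpos.ne', hβ.not_gt, hpos.not_gt]

end AddValuation


/-- The sign of `v(P(β))` agrees with the sign of `v(β)` when `P(β) ≠ 0`; in particular,
along a backward orbit (branch) `α` with `v(α 0) ∉ {0, ∞}`, every `v(α n)` has the same
sign as `v(α 0)`. -/
theorem stmt_6 (p r : ℕ) (hp : p.Prime) (hr : 1 ≤ r) (q : ℕ) (hq : q = p ^ r)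
    (L : Type) [Field L] [CharZero L]
    (v : L → WithTop ℝ)
    (hv0 : ∀ x : L, v x = ⊤ ↔ x = 0)
    (hvmul : ∀ x y : L, v (x * y) = v x + v y)
    (hvadd : ∀ x y : L, min (v x) (v y) ≤ v (x + y))
    (P : Polynomial L) (hmonic : P.Monic) (hdeg : P.natDegree = q)
    (hP0 : P.coeff 0 = 0)
    (hPint : ∀ i, 1 ≤ i → i ≤ q - 1 → (1 : WithTop ℝ) ≤ v (P.coeff i)) :
    (∀ β : L, P.eval β ≠ 0 →
      ((0 < v (P.eval β) ↔ 0 < v β) ∧ (v (P.eval β) = 0 ↔ v β = 0) ∧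
        (v (P.eval β) < 0 ↔ v β < 0))) ∧
    (∀ α : ℕ → L, (∀ n : ℕ, 1 ≤ n → P.eval (α n) = α (n - 1)) →
      v (α 0) ≠ 0 → v (α 0) ≠ ⊤ →
      ∀ n : ℕ, (0 < v (α 0) → 0 < v (α n)) ∧ (v (α 0) < 0 → v (α n) < 0)) := by
  have hv1 : v 1 = 0 := by
    obtain ⟨a, ha⟩ := WithTop.ne_top_iff_exists.mp (mt (hv0 1).mp one_ne_zero)
    have h := hvmul 1 1
    rw [mul_one, ← ha, ← WithTop.coe_add, WithTop.coe_inj] at h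
    have ha0 : a = 0 := by linarith
    rw [← ha, ha0, WithTop.coe_zero]
  let w : AddValuation L (WithTop ℝ) := AddValuation.of v ((hv0 0).mpr rfl) hv1 hvadd hvmul
  have hdeg0 : P.natDegree ≠ 0 := by
    rw [hdeg, hq]
    exact pow_ne_zero r hp.ne_zero
  have hcoeff : ∀ i < P.natDegree, 0 < w (P.coeff i) := by
    intro i hi
    rcases Nat.eq_zero_or_pos i with rfl | hi0
    · rw [hP0, w.map_zero]
      exact (WithTop.coe_lt_top 0)
    · exact zero_lt_one.trans_le (hPint i hi0 (by omega))
  have key : ∀ β : L, (0 < v (P.eval β) ↔ 0 < v β) ∧ (v (P.eval β) = 0 ↔ v β = 0) ∧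
      (v (P.eval β) < 0 ↔ v β < 0) := w.eval_sign_iff hmonic hdeg0 hcoeff
  refine ⟨fun β _ => key β, fun α hα _ _ n => ?_⟩
  induction n with
  | zero => exact ⟨id, id⟩
  | succ n ih =>
    have hk := key (α (n + 1))
    rw [hα (n + 1) (by omega), Nat.add_sub_cancel] at hk
    exact ⟨fun h => hk.1.mp (ih.1 h), fun h => hk.2.2.mp (ih.2 h)⟩
end

section
/- There exists an integer N such that for all n ≥ N and all k ≥ 0, v(α_{n+k}) = v(α_n)/q^k. -/
section BranchValuation

variable {L : Type*} [Field L]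

/-- If `x ^ deg P` has strictly smaller valuation than all other terms of the monic polynomial
`P` at `x`, it determines the valuation of `P.eval x`. -/
theorem AddValuation.eval_eq_of_forall_lt (w : AddValuation L (WithTop ℝ)) {P : Polynomial L}
    (hP : P.Monic) {x : L} (h : ∀ i < P.natDegree, w (x ^ P.natDegree) < w (P.coeff i * x ^ i))
    (hx : x ≠ 0) : w (P.eval x) = w (x ^ P.natDegree) := by
  rw [Polynomial.eval_eq_sum_range, Finset.sum_range_succ, hP.coeff_natDegree, one_mul]
  refine w.map_add_eq_of_lt_right (w.map_lt_sum ?_ fun i hi => h i (Finset.mem_range.mp hi))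
  exact (w.ne_top_iff).2 (pow_ne_zero _ hx)

theorem AddValuation.pow_eq_coe (w : AddValuation L (WithTop ℝ)) {x : L} {t : ℝ}
    (h : w x = (t : WithTop ℝ)) (n : ℕ) : w (x ^ n) = ((n * t : ℝ) : WithTop ℝ) := by
  rw [w.map_pow, h, ← WithTop.coe_nsmul, nsmul_eq_mul]

theorem AddValuation.eval_of_nonpos (w : AddValuation L (WithTop ℝ)) {P : Polynomial L}
    (hP : P.Monic) (hred : ∀ i < P.natDegree, 0 < w (P.coeff i)) {x : L} {t : ℝ}
    (hx : w x = (t : WithTop ℝ)) (ht : t ≤ 0) :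
    w (P.eval x) = ((P.natDegree * t : ℝ) : WithTop ℝ) := by
  rw [← w.pow_eq_coe hx]
  refine w.eval_eq_of_forall_lt hP (fun i hi => ?_) (w.ne_top_iff.1 (by simp [hx]))
  have hc := hred i hi
  have hi' : (i : ℝ) ≤ P.natDegree := by exact_mod_cast hi.le
  rw [w.map_mul, w.pow_eq_coe hx, w.pow_eq_coe hx]
  cases hw : w (P.coeff i) with
  | top => rw [top_add]; exact WithTop.coe_lt_top _
  | coe c =>
    rw [hw] at hc
    have hc' : 0 < c := by exact_mod_cast hc
    norm_cast
    nlinarith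

theorem AddValuation.one_add_le_term (w : AddValuation L (WithTop ℝ)) {P : Polynomial L}
    (hred : ∀ i < P.natDegree, 1 ≤ w (P.coeff i)) (h0 : P.coeff 0 = 0) {x : L} {t : ℝ}
    (hx : w x = (t : WithTop ℝ)) (ht : 0 ≤ t) {i : ℕ} (hi : i < P.natDegree) :
    ((1 + t : ℝ) : WithTop ℝ) ≤ w (P.coeff i * x ^ i) := by
  rcases Nat.eq_zero_or_pos i with rfl | hi0
  · simp [h0]
  have hc := hred i hi
  have hi' : (1 : ℝ) ≤ i := by exact_mod_cast hi0
  rw [w.map_mul, w.pow_eq_coe hx]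
  cases hw : w (P.coeff i) with
  | top => simp
  | coe c =>
    rw [hw] at hc
    have hc' : 1 ≤ c := by exact_mod_cast hc
    norm_cast
    nlinarith

theorem AddValuation.eval_of_small (w : AddValuation L (WithTop ℝ)) {P : Polynomial L}
    (hP : P.Monic) (hred : ∀ i < P.natDegree, 1 ≤ w (P.coeff i)) (h0 : P.coeff 0 = 0) {x : L}
    {t : ℝ} (hx : w x = (t : WithTop ℝ)) (ht : 0 ≤ t) (hsmall : P.natDegree * t < 1 + t) :
    w (P.eval x) = ((P.natDegree * t : ℝ) : WithTop ℝ) := by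
  rw [← w.pow_eq_coe hx]
  refine w.eval_eq_of_forall_lt hP (fun i hi => ?_) (w.ne_top_iff.1 (by simp [hx]))
  refine lt_of_lt_of_le ?_ (w.one_add_le_term hred h0 hx ht hi)
  rw [w.pow_eq_coe hx]
  exact_mod_cast hsmall

theorem AddValuation.one_add_le_eval (w : AddValuation L (WithTop ℝ)) {P : Polynomial L}
    (hP : P.Monic) (hred : ∀ i < P.natDegree, 1 ≤ w (P.coeff i)) (h0 : P.coeff 0 = 0) {x : L}
    {t : ℝ} (hx : w x = (t : WithTop ℝ)) (ht : 0 ≤ t) (hlarge : 1 + t ≤ P.natDegree * t) :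
    ((1 + t : ℝ) : WithTop ℝ) ≤ w (P.eval x) := by
  rw [Polynomial.eval_eq_sum_range, Finset.sum_range_succ, hP.coeff_natDegree, one_mul]
  refine w.map_le_add
    (w.map_le_sum fun i hi => w.one_add_le_term hred h0 hx ht (Finset.mem_range.mp hi)) ?_
  rw [w.pow_eq_coe hx]
  exact_mod_cast hlarge

/-- A sequence of positive reals, each term of which is either contracted by the factor `q` or
decreased by at least `1`, is eventually contracted by `q`. -/
theorem exists_forall_eq_mul_of_pos {q : ℝ} (hq : 2 ≤ q) {u : ℕ → ℝ} (hu : ∀ n, 0 < u n)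
    (hsmall : ∀ n, q * u (n + 1) < 1 + u (n + 1) → u n = q * u (n + 1))
    (hlarge : ∀ n, 1 + u (n + 1) ≤ q * u (n + 1) → 1 + u (n + 1) ≤ u n) :
    ∃ N, ∀ n, N ≤ n → u n = q * u (n + 1) := by
  have hle : ∀ n, u (n + 1) ≤ u n := fun n => by
    rcases lt_or_ge (q * u (n + 1)) (1 + u (n + 1)) with h | h
    · nlinarith [hsmall n h, hu (n + 1)]
    · linarith [hlarge n h]
  have hanti : Antitone u := antitone_nat_of_succ_le hle
  obtain ⟨N, hN⟩ : ∃ N, q * u (N + 1) < 1 + u (N + 1) := by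
    by_contra! hcon
    have hbound : ∀ n : ℕ, u n ≤ u 0 - n := fun n => by
      induction n with
      | zero => simp
      | succ n ih =>
        push_cast
        linarith [hlarge n (hcon n)]
    obtain ⟨n, hn⟩ := exists_nat_gt (u 0)
    linarith [hbound n, hu n]
  refine ⟨N, fun n hn => hsmall n ?_⟩
  have := hanti (Nat.add_le_add_right hn 1)
  nlinarith

end BranchValuation


/-- Along a branch `α` of preimages under `P` (a monic degree-`q = p^r` polynomial with
`P ≡ X^q` mod the maximal ideal, base point of nonzero valuation), eventually
`v(α (n+k)) = v(α n)/q^k` for all `k`. Here `K` is a complete discretely valued field of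
characteristic zero with perfect residue field of characteristic `p`, `L` its algebraic
closure, and `v` the (additive, real-valued) extension of the normalized valuation of `K`. -/
theorem stmt_7 (p r : ℕ) (hp : p.Prime) (hr : 1 ≤ r) (q : ℕ) (hq : q = p ^ r)
    (K : Type) [Field K] [CharZero K]
    (L : Type) [Field L] [Algebra K L] [IsAlgClosure K L]
    (v : L → WithTop ℝ)
    (hv0 : ∀ x : L, v x = ⊤ ↔ x = 0)
    (hvmul : ∀ x y : L, v (x * y) = v x + v y)
    (hvadd : ∀ x y : L, min (v x) (v y) ≤ v (x + y))
    -- the valuation is normalized so that `v(K^×) = ℤ`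
    (hdisc : ∀ x : K, x ≠ 0 → ∃ m : ℤ, v (algebraMap K L x) = ((m : ℝ) : WithTop ℝ))
    (hsurj : ∀ m : ℤ, ∃ x : K, v (algebraMap K L x) = ((m : ℝ) : WithTop ℝ))
    -- `K` is complete with respect to its valuation
    (hcomplete : ∀ f : ℕ → K,
      (∀ C : ℝ, ∃ N : ℕ, ∀ m ≥ N, ∀ n ≥ N,
        ((C : ℝ) : WithTop ℝ) < v (algebraMap K L (f m - f n))) →
      ∃ x : K, ∀ C : ℝ, ∃ N : ℕ, ∀ n ≥ N,
        ((C : ℝ) : WithTop ℝ) < v (algebraMap K L (f n - x)))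
    -- the residue field of `K` has characteristic `p`
    (hresp : 0 < v ((p : L)))
    -- the residue field of `K` is perfect
    (hperf : ∀ x : K, 0 ≤ v (algebraMap K L x) →
      ∃ y : K, 0 ≤ v (algebraMap K L y) ∧ 0 < v (algebraMap K L (x - y ^ p)))
    -- `P` is monic of degree `q`, has coefficients in `O_K`, `P(0) = 0`,
    -- and `P ≡ X^q` modulo the maximal ideal
    (P : Polynomial L) (hmonic : P.Monic) (hdeg : P.natDegree = q)
    (hP0 : P.coeff 0 = 0)
    (hPK : ∀ i, ∃ c : K, 0 ≤ v (algebraMap K L c) ∧ P.coeff i = algebraMap K L c)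
    (hPred : ∀ i < q, 0 < v (P.coeff i))
    -- the branch
    (α : ℕ → L) (α₀ : K) (hα0 : α 0 = algebraMap K L α₀)
    (hbranch : ∀ n : ℕ, 1 ≤ n → P.eval (α n) = α (n - 1))
    (hv0α : v (α 0) ≠ 0) (hαne : ∀ n, α n ≠ 0) :
    ∃ N : ℕ, ∀ n : ℕ, N ≤ n → ∀ k : ℕ, ∃ x : ℝ,
      v (α n) = (x : WithTop ℝ) ∧
      v (α (n + k)) = ((x / q ^ k : ℝ) : WithTop ℝ) := by
  have hv1 : v 1 = 0 := by
    obtain ⟨t, ht⟩ := WithTop.ne_top_iff_exists.1 (mt (hv0 1).1 one_ne_zero)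
    have h := hvmul 1 1
    rw [mul_one, ← ht] at h
    rw [← ht]
    norm_cast at h ⊢
    linarith
  let w : AddValuation L (WithTop ℝ) := AddValuation.of v ((hv0 0).2 rfl) hv1 hvadd hvmul
  have hred : ∀ i < P.natDegree, 0 < w (P.coeff i) := fun i hi => hPred i (hdeg ▸ hi)
  have hred1 : ∀ i < P.natDegree, 1 ≤ w (P.coeff i) := fun i hi => by
    obtain ⟨c, -, hc⟩ := hPK i
    have hpos := hred i hi
    rcases eq_or_ne c 0 with rfl | hc0
    · simp [hc]
    · obtain ⟨m, hm⟩ := hdisc c hc0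
      have hm' : w (P.coeff i) = ((m : ℝ) : WithTop ℝ) := by rw [hc]; exact hm
      rw [hm'] at hpos ⊢
      have : 0 < m := by exact_mod_cast hpos
      exact_mod_cast (show (1 : ℤ) ≤ m from this)
  have hq2 : (2 : ℝ) ≤ q := by
    have : 2 ≤ q := hq ▸ hp.two_le.trans (Nat.le_self_pow (by lia) p)
    exact_mod_cast this
  have hfin : ∀ n, ∃ t : ℝ, w (α n) = t := fun n =>
    (WithTop.ne_top_iff_exists.1 (mt (hv0 _).1 (hαne n))).imp fun _ h => h.symm
  choose u hu using hfin
  have heval : ∀ n, w (P.eval (α (n + 1))) = u n := fun n => by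
    rw [hbranch (n + 1) (by lia), Nat.add_sub_cancel, hu]
  have hnonpos : ∀ n, u (n + 1) ≤ 0 → u n = q * u (n + 1) := fun n h => by
    have := w.eval_of_nonpos hmonic hred (hu (n + 1)) h
    rw [heval, hdeg] at this
    exact_mod_cast this
  have hsmall : ∀ n, 0 ≤ u (n + 1) → q * u (n + 1) < 1 + u (n + 1) → u n = q * u (n + 1) :=
    fun n h0 h => by
      have := w.eval_of_small hmonic hred1 hP0 (hu (n + 1)) h0 (by rwa [hdeg])
      rw [heval, hdeg] at this
      exact_mod_cast this
  have hlarge : ∀ n, 0 ≤ u (n + 1) → 1 + u (n + 1) ≤ q * u (n + 1) → 1 + u (n + 1) ≤ u n :=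
    fun n h0 h => by
      have := w.one_add_le_eval hmonic hred1 hP0 (hu (n + 1)) h0 (by rwa [hdeg])
      rw [heval] at this
      exact_mod_cast this
  have hu0 : u 0 ≠ 0 := fun h => hv0α ((hu 0).trans (by simp [h]))
  obtain ⟨N, hN⟩ : ∃ N, ∀ n, N ≤ n → u n = q * u (n + 1) := by
    rcases hu0.lt_or_gt with hneg | hpos
    · have hneg' : ∀ n, u n < 0 := fun n => by
        induction n with
        | zero => exact hneg
        | succ n ih =>
          by_contra! h
          rcases lt_or_ge (q * u (n + 1)) (1 + u (n + 1)) with h' | h'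
          · nlinarith [hsmall n h h']
          · linarith [hlarge n h h']
      exact ⟨0, fun n _ => hnonpos n (hneg' _).le⟩
    · have hpos' : ∀ n, 0 < u n := fun n => by
        induction n with
        | zero => exact hpos
        | succ n ih =>
          by_contra! h
          nlinarith [hnonpos n h]
      exact exists_forall_eq_mul_of_pos hq2 hpos' (fun n => hsmall n (hpos' _).le)
        (fun n => hlarge n (hpos' _).le)
  refine ⟨N, fun n hn k => ⟨u n, hu n, (hu (n + k)).trans ?_⟩⟩
  norm_cast
  push_cast
  have hq0 : (q : ℝ) ≠ 0 := by linarith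
  rw [eq_div_iff (pow_ne_zero _ hq0)]
  induction k with
  | zero => simp
  | succ k ih =>
    rw [← ih, hN (n + k) (by lia), ← add_assoc, pow_succ]
    ring
end

section
/- There exists an integer N such that for all n ≥ N the extension K_n/K_{n−1} is totally ramified of degree q; that is, [K_n : K_{n−1}] = q and the ramification index of K_n over K_{n−1} equals q. -/
open Polynomial IntermediateField

/-- The value group of an intermediate field `F` under a real valuation of `L`. -/
def IntermediateField.realValueGroup {K L : Type*} [Field K] [Field L] [Algebra K L]
    (V : AddValuation L (WithTop ℝ)) (F : IntermediateField K L) : AddSubgroup ℝ where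
  carrier := {y | ∃ x ∈ F, x ≠ 0 ∧ V x = (y : WithTop ℝ)}
  zero_mem' := ⟨1, F.one_mem, one_ne_zero, by simp⟩
  add_mem' := by
    rintro a b ⟨x, hx, hx0, hxa⟩ ⟨y, hy, hy0, hyb⟩
    exact ⟨x * y, F.mul_mem hx hy, mul_ne_zero hx0 hy0, by simp [hxa, hyb]⟩
  neg_mem' := by
    rintro a ⟨x, hx, hx0, hxa⟩
    have hne : V x⁻¹ ≠ ⊤ := by simpa [AddValuation.top_iff] using hx0
    obtain ⟨b, hb⟩ := WithTop.ne_top_iff_exists.1 hne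
    refine ⟨x⁻¹, F.inv_mem hx, inv_ne_zero hx0, ?_⟩
    have h : V (x * x⁻¹) = 0 := by rw [mul_inv_cancel₀ hx0, V.map_one]
    rw [V.map_mul, hxa, ← hb] at h
    rw [← hb]
    norm_cast at h ⊢
    linarith

section

variable {K L : Type*} [Field K] [Field L] [Algebra K L] {V : AddValuation L (WithTop ℝ)}

theorem IntermediateField.mem_realValueGroup {F : IntermediateField K L} {y : ℝ} :
    y ∈ F.realValueGroup V ↔ ∃ x ∈ F, x ≠ 0 ∧ V x = (y : WithTop ℝ) :=
  Iff.rfl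

theorem IntermediateField.realValueGroup_mono {F E : IntermediateField K L} (h : F ≤ E) :
    F.realValueGroup V ≤ E.realValueGroup V :=
  fun _ ⟨x, hx, hx0, hxy⟩ => ⟨x, h hx, hx0, hxy⟩

theorem AddValuation.sum_ne_zero_of_injOn {ι : Type*} {s : Finset ι} {f : ι → L}
    (hs : s.Nonempty) (hf : ∀ i ∈ s, f i ≠ 0)
    (hinj : Set.InjOn (fun i => V (f i)) s) : ∑ i ∈ s, f i ≠ 0 := by
  classical
  obtain ⟨i, hi, hmin⟩ := s.exists_min_image (fun i => V (f i)) hs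
  intro h0
  have hlt : V (f i) < V (∑ j ∈ s.erase i, f j) := by
    refine V.map_lt_sum ?_ fun j hj => ?_
    · simpa [AddValuation.top_iff] using hf i hi
    · obtain ⟨hji, hj⟩ := Finset.mem_erase.1 hj
      exact lt_of_le_of_ne (hmin j hj) fun h => hji (hinj hj hi h.symm)
  have h : ∑ j ∈ s.erase i, f j = -f i := by
    rw [← Finset.add_sum_erase s f hi] at h0
    linear_combination h0
  rw [h, V.map_neg] at hlt
  exact lt_irrefl _ hlt

/-- Elements whose values are distinct modulo the value group of `F` are linearly independent
over `F`. -/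
theorem IntermediateField.linearIndependent_of_realValueGroup {F : IntermediateField K L}
    {ι : Type*} {x : ι → L} {γ : ι → ℝ} (hx : ∀ i, V (x i) = (γ i : WithTop ℝ))
    (hγ : ∀ i j, γ i - γ j ∈ F.realValueGroup V → i = j) : LinearIndependent F x := by
  classical
  have hx0 : ∀ i, x i ≠ 0 := fun i h => by simpa [h] using hx i
  rw [linearIndependent_iff']
  intro s g hsum
  by_contra! hne
  obtain ⟨i, hi, hgi⟩ := hne
  have hsmul : ∀ j, g j • x j = (g j : L) * x j := fun j => rfl
  refine AddValuation.sum_ne_zero_of_injOn (V := V) (s := s.filter fun j => g j ≠ 0)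
    (f := fun j => g j • x j) ⟨i, by simp [hi, hgi]⟩ ?_ ?_ ?_
  · intro j hj
    exact mul_ne_zero (by simpa using (Finset.mem_filter.1 hj).2) (hx0 j)
  · intro j hj k hk hjk
    have hgj : (g j : L) ≠ 0 := by simpa using (Finset.mem_filter.1 hj).2
    have hgk : (g k : L) ≠ 0 := by simpa using (Finset.mem_filter.1 hk).2
    obtain ⟨a, ha⟩ := WithTop.ne_top_iff_exists.1
      (show V (g j : L) ≠ ⊤ by simpa only [ne_eq, AddValuation.top_iff] using hgj)
    obtain ⟨b, hb⟩ := WithTop.ne_top_iff_exists.1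
      (show V (g k : L) ≠ ⊤ by simpa only [ne_eq, AddValuation.top_iff] using hgk)
    simp only [hsmul, V.map_mul, ← ha, ← hb, hx] at hjk
    norm_cast at hjk
    have hd : γ j - γ k = b - a := by linarith
    apply hγ
    rw [hd]
    exact sub_mem ⟨g k, (g k).2, hgk, hb.symm⟩ ⟨g j, (g j).2, hgj, ha.symm⟩
  · rw [Finset.sum_filter_of_ne, hsum]
    intro j _ h hg
    exact h (by rw [hg, zero_smul])

/-- The ramification index is finite and bounded by the degree. -/
theorem IntermediateField.relIndex_realValueGroup {F E : IntermediateField K L} (h : F ≤ E)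
    [FiniteDimensional F (extendScalars h)] :
    (F.realValueGroup V).relIndex (E.realValueGroup V) ≠ 0 ∧
      (F.realValueGroup V).relIndex (E.realValueGroup V) ≤ F.relfinrank E := by
  let Q := E.realValueGroup V ⧸ (F.realValueGroup V).addSubgroupOf (E.realValueGroup V)
  have hout : ∀ c : Q, ∃ x : extendScalars h, V (x : L) = (((c.out : E.realValueGroup V) : ℝ) :
      WithTop ℝ) := fun c => by
    obtain ⟨x, hx, -, hxc⟩ := c.out.2
    exact ⟨⟨x, hx⟩, hxc⟩
  choose b hb using hout
  have hli : LinearIndependent F b := by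
    refine LinearIndependent.of_comp (extendScalars h).val.toLinearMap ?_
    refine linearIndependent_of_realValueGroup (V := V) (γ := fun c => (c.out : ℝ)) hb ?_
    intro c d hcd
    rw [← Quotient.out_eq' c, ← Quotient.out_eq' d]
    refine (QuotientAddGroup.eq).2 ?_
    rw [AddSubgroup.mem_addSubgroupOf]
    have := neg_mem hcd
    push_cast
    convert this using 1
    ring
  have : Finite Q := hli.finite
  have := Fintype.ofFinite Q
  rw [relfinrank_eq_finrank_of_le h]
  refine ⟨Nat.card_pos (α := Q).ne', ?_⟩
  change Nat.card Q ≤ _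
  rw [Nat.card_eq_fintype_card]
  exact hli.fintype_card_le_finrank

theorem IntermediateField.extendScalars_adjoin_simple {F : IntermediateField K L} {β : L}
    (h : F ≤ adjoin K {β}) : extendScalars h = adjoin F {β} := by
  refine le_antisymm (fun x hx => ?_) ?_
  · have : adjoin K {β} ≤ (adjoin F {β}).restrictScalars K :=
      adjoin_le_iff.2 (Set.singleton_subset_iff.2 (mem_adjoin_simple_self F β))
    exact this hx
  · exact adjoin_le_iff.2 (Set.singleton_subset_iff.2 (mem_adjoin_simple_self K β))

theorem IntermediateField.finiteDimensional_extendScalars_adjoin [Algebra.IsAlgebraic K L]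
    {F : IntermediateField K L} {β : L} (h : F ≤ adjoin K {β}) :
    FiniteDimensional F (extendScalars h) := by
  rw [extendScalars_adjoin_simple h]
  exact adjoin.finiteDimensional (Algebra.IsIntegral.isIntegral (R := K) β).tower_top

theorem IntermediateField.relfinrank_adjoin_le [Algebra.IsAlgebraic K L]
    {F : IntermediateField K L} {β : L} (h : F ≤ adjoin K {β}) {R : F[X]} (hR : R.Monic)
    (hβ : aeval β R = 0) : F.relfinrank (adjoin K {β}) ≤ R.natDegree := by
  have hint : IsIntegral F β := (Algebra.IsIntegral.isIntegral (R := K) β).tower_top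
  rw [relfinrank_eq_finrank_of_le h, extendScalars_adjoin_simple h, adjoin.finrank hint]
  exact natDegree_le_natDegree (minpoly.min F β hR hβ)

end

theorem AddSubgroup.relIndex_zmultiples_zsmul {g : ℝ} (hg : g ≠ 0) (m : ℤ) :
    (zmultiples (m • g)).relIndex (zmultiples g) = m.natAbs := by
  have hinj : Function.Injective (zmultiplesHom ℝ g) := fun a b hab => by
    simpa [hg] using hab
  have h1 : zmultiples (m • g) = (zmultiples m).map (zmultiplesHom ℝ g) := by
    rw [AddMonoidHom.map_zmultiples]; simp
  have h2 : zmultiples g = (⊤ : AddSubgroup ℤ).map (zmultiplesHom ℝ g) := by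
    rw [← Int.zmultiples_one, AddMonoidHom.map_zmultiples]; simp
  rw [h1, h2, relIndex_map_map_of_injective _ _ hinj, relIndex_top_right, Int.index_zmultiples]

/-- A real group containing a cyclic group with nonzero (finite) index is cyclic. -/
theorem AddSubgroup.eq_zmultiples_of_relIndex_ne_zero {G : AddSubgroup ℝ} {a : ℝ}
    (h : (zmultiples a).relIndex G ≠ 0) : ∃ g, G = zmultiples g := by
  set e := (zmultiples a).relIndex G
  have he : (e : ℝ) ≠ 0 := by exact_mod_cast h
  have hle : G ≤ zmultiples (a / e) := fun t ht => by
    obtain ⟨k, hk⟩ := mem_zmultiples_iff.1 (nsmul_relIndex_mem (zmultiples a) ht)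
    refine mem_zmultiples_iff.2 ⟨k, ?_⟩
    simp only [zsmul_eq_mul, nsmul_eq_mul] at hk ⊢
    field_simp
    exact hk
  have hcyc : IsAddCyclic (G.addSubgroupOf (zmultiples (a / e))) := inferInstance
  obtain ⟨⟨⟨g, hg⟩, hgG⟩, hsurj⟩ := hcyc.exists_zsmul_surjective
  refine ⟨g, le_antisymm (fun t ht => ?_) ?_⟩
  · obtain ⟨k, hk⟩ := hsurj ⟨⟨t, hle ht⟩, ht⟩
    refine mem_zmultiples_iff.2 ⟨k, ?_⟩
    simpa using congrArg (fun y : G.addSubgroupOf (zmultiples (a / e)) =>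
      ((y : zmultiples (a / e)) : ℝ)) hk
  · exact (zmultiples_le).2 hgG

/-- An eventually non-increasing sequence of natural numbers is eventually constant. -/
theorem Nat.exists_forall_eq_of_antitone_from {k : ℕ → ℕ} {M : ℕ}
    (h : ∀ n ≥ M, k (n + 1) ≤ k n) : ∃ N ≥ M, ∀ n ≥ N, k (n + 1) = k n := by
  have hanti : Antitone fun n => k (M + n) :=
    antitone_nat_of_succ_le fun n => h (M + n) (Nat.le_add_right _ _)
  obtain ⟨N, hN⟩ := WellFoundedLT.antitone_chain_condition hanti
  refine ⟨M + N, by omega, fun n hn => ?_⟩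
  obtain ⟨j, rfl⟩ := Nat.exists_eq_add_of_le (show M ≤ n by omega)
  exact (hN (j + 1) (by omega)).symm.trans (hN j (by omega))

theorem AddValuation.eval_eq_of_lt {L : Type*} [Field L] {V : AddValuation L (WithTop ℝ)}
    {P : L[X]} (hP : P.Monic) (h0 : P.natDegree ≠ 0)
    (hcoeff : ∀ i < P.natDegree, ((1 : ℝ) : WithTop ℝ) ≤ V (P.coeff i)) {x : L} {a : ℝ}
    (hx : V x = (a : WithTop ℝ)) (ha : a < 1 / P.natDegree) :
    V (P.eval x) = ((P.natDegree * a : ℝ) : WithTop ℝ) := by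
  have hpow : ∀ i : ℕ, V (x ^ i) = ((i * a : ℝ) : WithTop ℝ) := fun i => by
    rw [V.map_pow, hx, ← WithTop.coe_nsmul, nsmul_eq_mul]
  have hq : (0 : ℝ) < P.natDegree := by positivity
  have hlt : ((P.natDegree * a : ℝ) : WithTop ℝ) <
      V (∑ i ∈ Finset.range P.natDegree, P.coeff i * x ^ i) := by
    refine V.map_lt_sum WithTop.coe_ne_top fun i hi => ?_
    have hi := Finset.mem_range.1 hi
    have hi' : (i : ℝ) ≤ P.natDegree := by exact_mod_cast hi.le
    rw [V.map_mul, hpow]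
    refine lt_of_lt_of_le ?_ (add_le_add_left (hcoeff i hi) _)
    norm_cast
    rw [lt_div_iff₀ hq] at ha
    rcases le_total a 0 with h | h
    · nlinarith
    · have : (0 : ℝ) ≤ i * a := by positivity
      linarith
  rw [eval_eq_sum_range, Finset.sum_range_succ, hP.coeff_natDegree, one_mul,
    V.map_add_eq_of_lt_right (by rwa [hpow]), hpow]

theorem AddValuation.add_le_eval {L : Type*} [Field L] {V : AddValuation L (WithTop ℝ)}
    {P : L[X]} (hP : P.Monic) (h2 : 2 ≤ P.natDegree) (hP0 : P.coeff 0 = 0)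
    (hcoeff : ∀ i < P.natDegree, ((1 : ℝ) : WithTop ℝ) ≤ V (P.coeff i)) {x : L} {a : ℝ}
    (hx : V x = (a : WithTop ℝ)) (ha : 1 / P.natDegree ≤ a) :
    ((a + 1 / P.natDegree : ℝ) : WithTop ℝ) ≤ V (P.eval x) := by
  have hpow : ∀ i : ℕ, V (x ^ i) = ((i * a : ℝ) : WithTop ℝ) := fun i => by
    rw [V.map_pow, hx, ← WithTop.coe_nsmul, nsmul_eq_mul]
  have h2' : (2 : ℝ) ≤ P.natDegree := by exact_mod_cast h2
  have hq : (0 : ℝ) < P.natDegree := by linarith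
  have hq1 : (1 : ℝ) / P.natDegree ≤ 1 := by rw [div_le_one hq]; linarith
  have ha0 : 0 < a := lt_of_lt_of_le (by positivity) ha
  rw [eval_eq_sum_range]
  refine V.map_le_sum fun i hi => ?_
  rcases (Nat.lt_succ_iff.1 (Finset.mem_range.1 hi)).eq_or_lt with rfl | hi
  · rw [hP.coeff_natDegree, one_mul, hpow]
    norm_cast
    nlinarith
  · rcases Nat.eq_zero_or_pos i with rfl | hi0
    · simp [hP0]
    have hi1 : (1 : ℝ) ≤ i := by exact_mod_cast hi0
    rw [V.map_mul, hpow]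
    refine le_trans ?_ (add_le_add_left (hcoeff i hi) _)
    norm_cast
    nlinarith

theorem exists_forall_eq_mul_succ {a : ℕ → ℝ} {q : ℝ} (hq : 0 < q)
    (hsmall : ∀ n, a (n + 1) < 1 / q → a n = q * a (n + 1))
    (hlarge : ∀ n, 1 / q ≤ a (n + 1) → a (n + 1) + 1 / q ≤ a n) :
    ∃ M, ∀ n ≥ M, a n = q * a (n + 1) := by
  have hq' : 0 < 1 / q := by positivity
  obtain ⟨M, hM⟩ : ∃ M, a M < 1 / q := by
    by_contra! h
    have hle : ∀ n : ℕ, a n + n * (1 / q) ≤ a 0 := fun n => by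
      induction n with
      | zero => simp
      | succ n ih =>
        have := hlarge n (h (n + 1))
        push_cast
        linarith
    obtain ⟨n, hn⟩ := exists_nat_gt (a 0 / (1 / q))
    rw [div_lt_iff₀ hq'] at hn
    linarith [hle n, h n]
  have hlt : ∀ n ≥ M, a n < 1 / q := fun n hn => by
    induction n, hn using Nat.le_induction with
    | base => exact hM
    | succ n hn ih =>
      by_contra! h
      linarith [hlarge n h]
  exact ⟨M, fun n hn => hsmall n (hlt (n + 1) (by omega))⟩

/-- Eventually each step `K_n / K_{n-1}` of the branch tower, with `K_n = K(α n)`, is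
totally ramified of degree `q`: the relative degree `[K_n : K_{n-1}]` is `q`, and the
ramification index is `q`, i.e. the value group of `K_n` is `1/q` times that of `K_{n-1}`. -/
theorem stmt_8 (p r : ℕ) (hp : p.Prime) (hr : 1 ≤ r) (q : ℕ) (hq : q = p ^ r)
    (K : Type) [Field K] [CharZero K]
    (L : Type) [Field L] [Algebra K L] [IsAlgClosure K L]
    (v : L → WithTop ℝ)
    (hv0 : ∀ x : L, v x = ⊤ ↔ x = 0)
    (hvmul : ∀ x y : L, v (x * y) = v x + v y)
    (hvadd : ∀ x y : L, min (v x) (v y) ≤ v (x + y))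
    (hdisc : ∀ x : K, x ≠ 0 → ∃ m : ℤ, v (algebraMap K L x) = ((m : ℝ) : WithTop ℝ))
    (hsurj : ∀ m : ℤ, ∃ x : K, v (algebraMap K L x) = ((m : ℝ) : WithTop ℝ))
    (hcomplete : ∀ f : ℕ → K,
      (∀ C : ℝ, ∃ N : ℕ, ∀ m ≥ N, ∀ n ≥ N,
        ((C : ℝ) : WithTop ℝ) < v (algebraMap K L (f m - f n))) →
      ∃ x : K, ∀ C : ℝ, ∃ N : ℕ, ∀ n ≥ N,
        ((C : ℝ) : WithTop ℝ) < v (algebraMap K L (f n - x)))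
    (hresp : 0 < v ((p : L)))
    (hperf : ∀ x : K, 0 ≤ v (algebraMap K L x) →
      ∃ y : K, 0 ≤ v (algebraMap K L y) ∧ 0 < v (algebraMap K L (x - y ^ p)))
    (P : Polynomial L) (hmonic : P.Monic) (hdeg : P.natDegree = q)
    (hP0 : P.coeff 0 = 0)
    (hPK : ∀ i, ∃ c : K, 0 ≤ v (algebraMap K L c) ∧ P.coeff i = algebraMap K L c)
    (hPred : ∀ i < q, 0 < v (P.coeff i))
    (α : ℕ → L) (α₀ : K) (hα0 : α 0 = algebraMap K L α₀)
    (hbranch : ∀ n : ℕ, 1 ≤ n → P.eval (α n) = α (n - 1))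
    (hv0α : v (α 0) ≠ 0) (hαne : ∀ n, α n ≠ 0) :
    ∃ N : ℕ, 1 ≤ N ∧ ∀ n : ℕ, N ≤ n →
      -- `[K_n : K_{n-1}] = q`
      (IntermediateField.adjoin K {α (n - 1)}).relfinrank
          (IntermediateField.adjoin K {α n}) = q ∧
      -- the ramification index of `K_n / K_{n-1}` is `q`:
      -- the value group of `K_n` is `1/q` times the value group of `K_{n-1}`
      {y : ℝ | ∃ x ∈ IntermediateField.adjoin K {α n}, x ≠ 0 ∧ v x = (y : WithTop ℝ)} =
        (fun t : ℝ => t / q) ''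
          {y : ℝ | ∃ x ∈ IntermediateField.adjoin K {α (n - 1)}, x ≠ 0 ∧
            v x = (y : WithTop ℝ)} := by
  have hpr : 2 ≤ p ^ r := hp.two_le.trans (Nat.le_self_pow (by omega) p)
  have h2 : 2 ≤ q := hq ▸ hpr
  have hqpos : 0 < q := by omega
  have hv1 : v 1 = 0 := by
    obtain ⟨m, hm⟩ := WithTop.ne_top_iff_exists.1 (mt (hv0 1).1 one_ne_zero)
    have h := hvmul 1 1
    rw [one_mul, ← hm] at h
    rw [← hm]
    norm_cast at h ⊢
    linarith
  obtain ⟨V, rfl⟩ : ∃ V : AddValuation L (WithTop ℝ), ⇑V = v :=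
    ⟨AddValuation.of v ((hv0 0).2 rfl) hv1 hvadd hvmul, rfl⟩
  have halg : Algebra.IsAlgebraic K L := IsAlgClosure.isAlgebraic
  -- `P` has coefficients in `K`, and its lower coefficients have value at least `1`.
  obtain ⟨Q, rfl⟩ : ∃ Q : K[X], Q.map (algebraMap K L) = P := by
    have : P ∈ lifts (algebraMap K L) := (lifts_iff_coeff_lifts P).2 fun i => by
      obtain ⟨c, -, hc⟩ := hPK i
      exact ⟨c, hc.symm⟩
    exact (mem_lifts P).1 this
  have hQ : Q.Monic := (monic_map_iff (f := algebraMap K L)).1 hmonic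
  have hcoeff : ∀ i < (Q.map (algebraMap K L)).natDegree,
      ((1 : ℝ) : WithTop ℝ) ≤ V ((Q.map (algebraMap K L)).coeff i) := fun i hi => by
    have hpos := hPred i (hdeg ▸ hi)
    rw [coeff_map] at hpos ⊢
    rcases eq_or_ne (Q.coeff i) 0 with h | h
    · simp [h]
    · obtain ⟨m, hm⟩ := hdisc _ h
      rw [hm] at hpos ⊢
      norm_cast at hpos ⊢
  have hstep : ∀ n, (Q.map (algebraMap K L)).eval (α (n + 1)) = α n := fun n =>
    hbranch (n + 1) (by omega)
  -- the values of the branch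
  have hval : ∀ n, ∃ a : ℝ, V (α n) = (a : WithTop ℝ) := fun n => by
    obtain ⟨a, ha⟩ := WithTop.ne_top_iff_exists.1 (mt (hv0 (α n)).1 (hαne n))
    exact ⟨a, ha.symm⟩
  choose a ha using hval
  have hq0 : (0 : ℝ) < q := by positivity
  have hsmall : ∀ n, a (n + 1) < 1 / q → a n = q * a (n + 1) := fun n hn => by
    have h := AddValuation.eval_eq_of_lt hmonic (by omega) hcoeff (ha (n + 1)) (by rwa [hdeg])
    rw [hstep, ha, hdeg] at h
    exact_mod_cast h
  have hlarge : ∀ n, 1 / q ≤ a (n + 1) → a (n + 1) + 1 / q ≤ a n := fun n hn => by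
    have h := AddValuation.add_le_eval hmonic (by omega) hP0 hcoeff (ha (n + 1)) (by rwa [hdeg])
    rw [hstep, ha, hdeg] at h
    exact_mod_cast h
  have hane : ∀ n, a n ≠ 0 := fun n => by
    induction n with
    | zero => intro h; rw [ha, h] at hv0α; simp at hv0α
    | succ n ih =>
      intro h
      exact ih (by rw [hsmall n (by rw [h]; positivity), h, mul_zero])
  obtain ⟨M, hM⟩ := exists_forall_eq_mul_succ hq0 hsmall hlarge
  -- the fields `K(α n)` form a tower with steps of degree at most `q`
  have hmono : ∀ n, adjoin K {α n} ≤ adjoin K {α (n + 1)} := fun n => by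
    refine adjoin_le_iff.2 (Set.singleton_subset_iff.2 ?_)
    rw [← hstep n, eval_map_algebraMap]
    have h := (aeval (AdjoinSimple.gen K (α (n + 1))) Q).2
    rwa [AdjoinSimple.coe_aeval_gen_apply] at h
  have hdegle : ∀ n, (adjoin K {α n}).relfinrank (adjoin K {α (n + 1)}) ≤ q := fun n => by
    set F := adjoin K {α n}
    let c : F := ⟨α n, mem_adjoin_simple_self K _⟩
    have hdF : (Q.map (algebraMap K F)).natDegree = q := by
      rw [natDegree_map, ← hdeg, natDegree_map]
    have hR : (Q.map (algebraMap K F) - C c).Monic :=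
      (hQ.map _).sub_of_left (degree_C_le.trans_lt (natDegree_pos_iff_degree_pos.1 (by omega)))
    refine (relfinrank_adjoin_le (hmono n) hR ?_).trans ?_
    · rw [map_sub, aeval_C, aeval_map_algebraMap, ← eval_map_algebraMap, hstep n]
      exact sub_self _
    · rw [natDegree_sub_C, hdF]
  -- the value groups are cyclic
  have hcyc : ∀ n, ∃ g : ℝ, (adjoin K {α n}).realValueGroup V = AddSubgroup.zmultiples g :=
    fun n => by
    refine AddSubgroup.eq_zmultiples_of_relIndex_ne_zero (a := 1) ?_
    have hbot :
        (⊥ : IntermediateField K L).realValueGroup V = AddSubgroup.zmultiples (1 : ℝ) := by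
      ext y
      rw [mem_realValueGroup, AddSubgroup.mem_zmultiples_iff]
      constructor
      · rintro ⟨x, hx, hx0, hxy⟩
        obtain ⟨x, rfl⟩ := mem_bot.1 hx
        obtain ⟨m, hm⟩ := hdisc x (by rintro rfl; simp at hx0)
        rw [hm] at hxy
        exact ⟨m, by simpa using WithTop.coe_injective hxy⟩
      · rintro ⟨m, rfl⟩
        obtain ⟨x, hx⟩ := hsurj m
        refine ⟨algebraMap K L x, IntermediateField.algebraMap_mem _ x, fun h => ?_,
          by simpa using hx⟩
        rw [h, V.map_zero] at hx
        exact WithTop.top_ne_coe hx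
    have hfin := finiteDimensional_extendScalars_adjoin (bot_le (a := adjoin K {α n}))
    rw [← hbot]
    exact (relIndex_realValueGroup bot_le).1
  choose g hg using hcyc
  have hmem : ∀ n, ∃ k : ℤ, k • g n = a n := fun n => by
    rw [← AddSubgroup.mem_zmultiples_iff, ← hg]
    exact ⟨α n, mem_adjoin_simple_self K _, hαne n, ha n⟩
  choose k hk using hmem
  have hg0 : ∀ n, g n ≠ 0 := fun n h => hane n (by rw [← hk, h, smul_zero])
  have hk0 : ∀ n, k n ≠ 0 := fun n h => hane n (by rw [← hk, h, zero_smul])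
  have hdvd : ∀ n, ∃ d : ℤ, d • g (n + 1) = g n := fun n => by
    rw [← AddSubgroup.mem_zmultiples_iff, ← hg]
    apply realValueGroup_mono (hmono n)
    rw [hg]
    exact AddSubgroup.mem_zmultiples _
  choose d hd using hdvd
  have hdrel : ∀ n, (d n).natAbs ≤ (adjoin K {α n}).relfinrank (adjoin K {α (n + 1)}) :=
    fun n => by
    have hfin := finiteDimensional_extendScalars_adjoin (hmono n)
    have h := (relIndex_realValueGroup (V := V) (hmono n)).2
    rwa [hg, hg, ← hd, AddSubgroup.relIndex_zmultiples_zsmul (hg0 _)] at h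
  have hkd : ∀ n ≥ M, (k n).natAbs * (d n).natAbs = q * (k (n + 1)).natAbs := fun n hn => by
    have h := hM n hn
    rw [← hk, ← hk, ← hd] at h
    simp only [zsmul_eq_mul] at h
    have h' : (k n : ℝ) * d n = q * k (n + 1) :=
      mul_right_cancel₀ (hg0 (n + 1)) (by linear_combination h)
    have h'' : k n * d n = q * k (n + 1) := by exact_mod_cast h'
    simpa [Int.natAbs_mul] using congrArg Int.natAbs h''
  obtain ⟨N, hN, hconst⟩ := Nat.exists_forall_eq_of_antitone_from (k := fun n => (k n).natAbs)
    (M := M) fun n hn => by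
      have h := (hdrel n).trans (hdegle n)
      have h' := hkd n hn
      refine le_of_mul_le_mul_left (?_ : q * _ ≤ q * _) hqpos
      rw [← h', mul_comm q]
      exact Nat.mul_le_mul_left _ h
  refine ⟨N + 1, by omega, fun n hn => ?_⟩
  obtain ⟨n, rfl⟩ := Nat.exists_eq_add_of_le' (show 1 ≤ n by omega)
  rw [Nat.add_sub_cancel]
  have hdq : (d n).natAbs = q := by
    have h := hkd n (by omega)
    rw [hconst n (by omega), mul_comm] at h
    exact Nat.eq_of_mul_eq_mul_right (Int.natAbs_pos.2 (hk0 n)) h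
  refine ⟨le_antisymm (hdegle n) (hdq ▸ hdrel n), ?_⟩
  have hgq : AddSubgroup.zmultiples (g n) = AddSubgroup.zmultiples ((q : ℝ) * g (n + 1)) := by
    rw [← hd n, ← hdq]
    rcases Int.natAbs_eq (d n) with h | h
    · rw [h]; simp
    · rw [h]; simp
  change ((adjoin K {α (n + 1)}).realValueGroup V : Set ℝ) =
    (fun t : ℝ => t / q) '' ((adjoin K {α n}).realValueGroup V : Set ℝ)
  rw [hg, hg, hgq]
  ext y
  simp only [Set.mem_image, SetLike.mem_coe, AddSubgroup.mem_zmultiples_iff, zsmul_eq_mul]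
  constructor
  · rintro ⟨j, rfl⟩
    exact ⟨_, ⟨j, rfl⟩, by field_simp⟩
  · rintro ⟨-, ⟨j, rfl⟩, rfl⟩
    exact ⟨j, by field_simp⟩
end

section
/- For each n let w_n denote the normalized discrete valuation of K_n (the unique valuation on K_n equivalent to the restriction of v with value group exactly ℤ), and set d_n = w_n(α_n). Then the sequence (d_n) is eventually constant: there exist integers N and d such that d_n = d for all n ≥ N. -/
open Polynomial IntermediateField

/-- A subgroup of `ℝ` in which every element has a multiple, by a factor between `1` and `q`, in
the subgroup generated by `a > 0` is generated by `a / m` for some `m` between `1` and `q`. -/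
theorem AddSubgroup.exists_eq_zmultiples_div {G : AddSubgroup ℝ} {a : ℝ} (ha : 0 < a)
    (haG : a ∈ G) {q : ℕ}
    (h : ∀ g ∈ G, ∃ k : ℕ, 1 ≤ k ∧ k ≤ q ∧ k • g ∈ AddSubgroup.zmultiples a) :
    ∃ m : ℕ, 1 ≤ m ∧ m ≤ q ∧ G = AddSubgroup.zmultiples (a / m) := by
  obtain ⟨k₀, hk₀, hkq₀, -⟩ := h a haG
  have hq : (0 : ℝ) < q := by exact_mod_cast (by omega : 0 < q)
  obtain ⟨b, hb⟩ := AddSubgroup.cyclic_of_isolated_zero (H := G) (a := a / q) (by positivity) (by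
    rw [Set.disjoint_left]
    rintro g hg ⟨hg0, hga⟩
    obtain ⟨k, hk, hkq, n, hn⟩ := h g hg
    have hk' : (1 : ℝ) ≤ k := by exact_mod_cast hk
    have hkq' : (k : ℝ) ≤ q := by exact_mod_cast hkq
    rw [lt_div_iff₀ hq] at hga
    simp only [zsmul_eq_mul, nsmul_eq_mul] at hn
    have h0 : (0 : ℝ) < n * a := by rw [hn]; positivity
    have h1 : (n : ℝ) * a < 1 * a := by rw [hn]; nlinarith
    have h2 : (0 : ℝ) < n := pos_of_mul_pos_left h0 ha.le
    have h3 : (n : ℝ) < 1 := lt_of_mul_lt_mul_right h1 ha.le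
    norm_cast at h2 h3
    omega)
  rw [← AddSubgroup.zmultiples_eq_closure] at hb
  wlog hb0 : 0 ≤ b generalizing b
  · exact this (-b) (by rw [hb, AddSubgroup.zmultiples_neg]) (by linarith)
  obtain ⟨m, hm⟩ : a ∈ AddSubgroup.zmultiples b := hb ▸ haG
  obtain ⟨k, hk, hkq, n, hn⟩ := h b (hb ▸ AddSubgroup.mem_zmultiples b)
  simp only [zsmul_eq_mul, nsmul_eq_mul] at hm hn
  have hb1 : 0 < b := hb0.lt_of_ne fun h0 => by simp [← h0] at hm; exact ha.ne hm
  have hm0 : 0 < m := by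
    have : (0 : ℝ) < m := pos_of_mul_pos_left (hm ▸ ha) hb0
    exact_mod_cast this
  have hnm : n * m = k := by
    have : (n : ℝ) * m = k := mul_right_cancel₀ hb1.ne' (by rw [mul_assoc, hm, hn])
    exact_mod_cast this
  have hmk : m ≤ k := Int.le_of_dvd (by omega) ⟨n, by rw [← hnm, mul_comm]⟩
  lift m to ℕ using hm0.le
  refine ⟨m, by omega, by omega, ?_⟩
  rw [hb, ← hm, Int.cast_natCast, mul_div_cancel_left₀]
  exact_mod_cast hm0.ne'

/-- A positive scalar carrying a cyclic subgroup of `ℝ` onto `ℤ` is the inverse of its positive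
generator. -/
theorem AddSubgroup.eq_of_image_zmultiples_inv {a c : ℝ} (ha : 0 < a) (hc : 0 < c)
    (h : (fun t : ℝ => c * t) '' (AddSubgroup.zmultiples a⁻¹ : Set ℝ) =
      Set.range ((↑) : ℤ → ℝ)) : c = a := by
  obtain ⟨m, hm⟩ : c * a⁻¹ ∈ Set.range ((↑) : ℤ → ℝ) :=
    h ▸ ⟨a⁻¹, AddSubgroup.mem_zmultiples _, rfl⟩
  obtain ⟨_, ⟨n, rfl⟩, hn⟩ :
      (1 : ℝ) ∈ (fun t : ℝ => c * t) '' (AddSubgroup.zmultiples a⁻¹ : Set ℝ) :=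
    h ▸ ⟨1, by simp⟩
  simp only [zsmul_eq_mul] at hn
  have hnm : n * m = 1 := by
    have : (n : ℝ) * m = 1 := by rw [hm, ← hn]; ring
    exact_mod_cast this
  have hm0 : 0 < m := by
    have : (0 : ℝ) < m := by rw [hm]; positivity
    exact_mod_cast this
  have hm1 : m = 1 := Int.eq_one_of_dvd_one hm0.le ⟨n, by rw [← hnm, mul_comm]⟩
  rw [hm1, Int.cast_one, ← div_eq_mul_inv, eq_div_iff ha.ne', one_mul] at hm
  exact hm.symm

/-- A sequence of integers with `q * d (n + 1) = m n * d n`, `1 ≤ m n ≤ q`, is eventually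
constant. -/
theorem Int.exists_eventually_const_of_mul_eq {d : ℕ → ℤ} {q N : ℕ}
    (h : ∀ n ≥ N, ∃ m : ℕ, 1 ≤ m ∧ m ≤ q ∧ q * d (n + 1) = m * d n) :
    ∃ M ≥ N, ∃ e : ℤ, ∀ n ≥ M, d n = e := by
  obtain ⟨M, hM, hmin⟩ : ∃ M ≥ N, ∀ n ≥ N, (d M).natAbs ≤ (d n).natAbs := by
    obtain ⟨M, hM, hmin⟩ := WellFounded.has_min (measure fun n => (d n).natAbs).wf (Set.Ici N)
      ⟨N, Set.self_mem_Ici⟩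
    exact ⟨M, hM, fun n hn => not_lt.mp (hmin n hn)⟩
  refine ⟨M, hM, d M, fun n hn => ?_⟩
  induction n, hn using Nat.le_induction with
  | base => rfl
  | succ n hn ih =>
    obtain ⟨m, hm, hmq, heq⟩ := h n (hM.trans hn)
    have hle := hmin (n + 1) (by omega)
    rw [ih] at heq
    have habs : q * (d (n + 1)).natAbs = m * (d M).natAbs := by
      simpa [Int.natAbs_mul] using congrArg Int.natAbs heq
    by_cases h0 : d M = 0
    · rw [h0, mul_zero, mul_eq_zero] at heq
      rw [h0]
      exact heq.resolve_left (by omega)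
    have hpos : 0 < (d M).natAbs := by omega
    have hqm : q ≤ m := by
      by_contra! hlt
      nlinarith
    obtain rfl : m = q := by omega
    exact mul_left_cancel₀ (by omega) heq

/-- An element of `F⟮a⟯` is a root of a nonzero polynomial of degree at most the degree of any
monic polynomial vanishing at `a`. -/
theorem exists_aeval_eq_zero_of_mem_adjoin_simple {F L : Type*} [Field F] [Field L] [Algebra F L]
    {f : F[X]} (hf : f.Monic) {a : L} (hroot : aeval a f = 0) {x : L} (hx : x ∈ F⟮a⟯) :
    ∃ g : F[X], g ≠ 0 ∧ aeval x g = 0 ∧ g.natDegree ≤ f.natDegree := by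
  have ha : IsIntegral F a := ⟨f, hf, hroot⟩
  have := adjoin.finiteDimensional ha
  refine ⟨minpoly F (⟨x, hx⟩ : F⟮a⟯), minpoly.ne_zero (IsIntegral.of_finite F _), ?_,
    (minpoly.natDegree_le _).trans ?_⟩
  · rw [← minpoly.algebraMap_eq (algebraMap F⟮a⟯ L).injective]
    exact minpoly.aeval F x
  · rw [adjoin.finrank ha]
    exact natDegree_le_natDegree (minpoly.min F a hf hroot)

namespace AddValuation

variable {K L : Type*} [Field K] [Field L] [Algebra K L] (w : AddValuation L (WithTop ℝ))

/-- The group of finite values taken by `w` on an intermediate field. -/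
def valueGroup (F : IntermediateField K L) : AddSubgroup ℝ where
  carrier := {y | ∃ x ∈ F, x ≠ 0 ∧ w x = (y : WithTop ℝ)}
  zero_mem' := ⟨1, F.one_mem, one_ne_zero, w.map_one⟩
  add_mem' := by
    rintro a b ⟨x, hxF, hx, hxa⟩ ⟨y, hyF, hy, hyb⟩
    exact ⟨x * y, F.mul_mem hxF hyF, mul_ne_zero hx hy, by
      rw [w.map_mul, hxa, hyb, WithTop.coe_add]⟩
  neg_mem' := by
    rintro a ⟨x, hxF, hx, hxa⟩
    refine ⟨x⁻¹, F.inv_mem hxF, inv_ne_zero hx, ?_⟩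
    rw [w.map_inv, hxa, WithTop.LinearOrderedAddCommGroup.coe_neg]

theorem mem_valueGroup {F : IntermediateField K L} {y : ℝ} :
    y ∈ w.valueGroup F ↔ ∃ x ∈ F, x ≠ 0 ∧ w x = (y : WithTop ℝ) := Iff.rfl

theorem exists_coe_eq {x : L} (hx : x ≠ 0) : ∃ t : ℝ, w x = (t : WithTop ℝ) :=
  (WithTop.ne_top_iff_exists.mp (w.ne_top_iff.mpr hx)).imp fun _ h => h.symm

/-- In a vanishing finite sum with a nonzero term, two nonzero terms have the same valuation. -/
theorem exists_ne_map_eq_of_sum_eq_zero {ι : Type*} (s : Finset ι) (g : ι → L)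
    (hsum : ∑ i ∈ s, g i = 0) (hg : ∃ i ∈ s, g i ≠ 0) :
    ∃ i ∈ s, ∃ j ∈ s, i ≠ j ∧ g i ≠ 0 ∧ w (g i) = w (g j) := by
  classical
  obtain ⟨i₀, hi₀, h₀⟩ := hg
  obtain ⟨i, hi, hmin⟩ := s.exists_min_image (fun i => w (g i)) ⟨i₀, hi₀⟩
  have hgi : g i ≠ 0 := by
    intro h
    have := hmin i₀ hi₀
    rw [h, w.map_zero, top_le_iff, w.top_iff] at this
    exact h₀ this
  by_contra! hcon
  have hlt : w (g i) < w (∑ j ∈ s.erase i, g j) := by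
    refine w.map_lt_sum (w.ne_top_iff.mpr hgi) fun j hj => ?_
    rw [Finset.mem_erase] at hj
    exact lt_of_le_of_ne (hmin j hj.2) (hcon i hi j hj.2 hj.1.symm hgi)
  rw [← Finset.add_sum_erase s g hi, add_eq_zero_iff_eq_neg] at hsum
  rw [hsum, w.map_neg] at hlt
  exact lt_irrefl _ hlt

/-- The value of a root of a polynomial over `F` is torsion modulo the value group of `F`, with
order at most the degree. -/
theorem exists_nsmul_mem_valueGroup {F : IntermediateField K L} {f : F[X]} (hf : f ≠ 0) {x : L}
    (hx : x ≠ 0) (hroot : aeval x f = 0) {y : ℝ} (hy : w x = (y : WithTop ℝ)) :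
    ∃ k : ℕ, 1 ≤ k ∧ k ≤ f.natDegree ∧ k • y ∈ w.valueGroup F := by
  rw [aeval_eq_sum_range] at hroot
  obtain ⟨i, hi, j, hj, hij, hne, heq⟩ := w.exists_ne_map_eq_of_sum_eq_zero _ _ hroot
    ⟨f.natDegree, by simp, by
      rw [Algebra.smul_def]
      exact mul_ne_zero (by simpa using hf) (pow_ne_zero _ hx)⟩
  have hne' : f.coeff j • x ^ j ≠ 0 := w.ne_top_iff.mp (heq ▸ w.ne_top_iff.mpr hne)
  wlog hlt : j < i generalizing i j
  · exact this j hj i hi hij.symm hne' heq.symm hne (by omega)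
  have hci : f.coeff i ≠ 0 := fun h => hne (by rw [h, zero_smul])
  have hcj : f.coeff j ≠ 0 := fun h => hne' (by rw [h, zero_smul])
  have hci' : (f.coeff i : L) ≠ 0 := by simpa using hci
  have hcj' : (f.coeff j : L) ≠ 0 := by simpa using hcj
  refine ⟨i - j, by omega, by have := Finset.mem_range.mp hi; omega, ?_⟩
  rw [mem_valueGroup]
  refine ⟨f.coeff j / f.coeff i, F.div_mem (f.coeff j).2 (f.coeff i).2, div_ne_zero hcj' hci', ?_⟩
  obtain ⟨a, ha⟩ := w.exists_coe_eq hci'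
  obtain ⟨b, hb⟩ := w.exists_coe_eq hcj'
  rw [Algebra.smul_def, Algebra.smul_def, w.map_mul, w.map_mul, w.map_pow, w.map_pow, hy] at heq
  simp only [IntermediateField.algebraMap_apply, ha, hb] at heq
  norm_cast at heq
  rw [w.map_div, ha, hb]
  norm_cast
  simp only [nsmul_eq_mul, Nat.cast_sub hlt.le] at heq ⊢
  linarith

theorem exists_nsmul_mem_valueGroup_of_mem_adjoin {F : IntermediateField K L} {f : F[X]}
    (hf : f.Monic) {a : L} (hroot : aeval a f = 0) {x : L} (hxa : x ∈ F⟮a⟯) (hx : x ≠ 0) {y : ℝ}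
    (hy : w x = (y : WithTop ℝ)) :
    ∃ k : ℕ, 1 ≤ k ∧ k ≤ f.natDegree ∧ k • y ∈ w.valueGroup F := by
  obtain ⟨g, hg, hgx, hgf⟩ := exists_aeval_eq_zero_of_mem_adjoin_simple hf hroot hxa
  obtain ⟨k, hk, hkd, hmem⟩ := w.exists_nsmul_mem_valueGroup hg hx hgx hy
  exact ⟨k, hk, hkd.trans hgf, hmem⟩

/-- If each lower term of a monic polynomial of degree `q` has larger valuation at `a` than the
leading term, then the value at `a` has valuation `q * w a`. -/
theorem map_eval_eq_of_forall_lt {P : L[X]} (hP : P.Monic) {a : L} {t : ℝ}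
    (ht : w a = (t : WithTop ℝ))
    (hterm : ∀ i < P.natDegree, ∀ c : ℝ, w (P.coeff i) = (c : WithTop ℝ) →
      P.natDegree * t < c + i * t) :
    w (P.eval a) = ((P.natDegree * t : ℝ) : WithTop ℝ) := by
  have hlead : w (a ^ P.natDegree) = ((P.natDegree * t : ℝ) : WithTop ℝ) := by
    rw [w.map_pow, ht]
    norm_cast
    simp
  rw [eval_eq_sum_range, Finset.sum_range_succ, hP.coeff_natDegree, one_mul,
    w.map_add_eq_of_lt_right, hlead]
  rw [hlead]
  refine w.map_lt_sum WithTop.coe_ne_top fun i hi => ?_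
  by_cases h : P.coeff i = 0
  · rw [h, zero_mul, w.map_zero]
    exact WithTop.coe_lt_top _
  obtain ⟨c, hc⟩ := w.exists_coe_eq h
  rw [w.map_mul, w.map_pow, hc, ht]
  norm_cast
  simpa using hterm i (Finset.mem_range.mp hi) c hc

/-- A lower bound for the valuation of a value of a monic polynomial. -/
theorem le_map_eval {P : L[X]} (hP : P.Monic) {a : L} {t b : ℝ}
    (ht : w a = (t : WithTop ℝ)) (hlead : b ≤ P.natDegree * t)
    (hterm : ∀ i < P.natDegree, ∀ c : ℝ, w (P.coeff i) = (c : WithTop ℝ) → b ≤ c + i * t) :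
    (b : WithTop ℝ) ≤ w (P.eval a) := by
  rw [eval_eq_sum_range]
  refine w.map_le_sum fun i hi => ?_
  by_cases h : P.coeff i = 0
  · rw [h, zero_mul, w.map_zero]
    exact le_top
  obtain ⟨c, hc⟩ := w.exists_coe_eq h
  rw [w.map_mul, w.map_pow, hc, ht]
  norm_cast
  rw [nsmul_eq_mul]
  rcases (Finset.mem_range_succ_iff.mp hi).lt_or_eq with hlt | rfl
  · exact hterm i hlt c hc
  · rw [hP.coeff_natDegree, w.map_one] at hc
    norm_cast at hc
    rwa [← hc, zero_add]

/-- Along a backward orbit of a polynomial congruent to `X ^ q` with coefficients of valuation at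
least `1` below the leading one and no constant term, starting at an element of nonzero valuation,
each step eventually divides the valuation by `q`. -/
theorem exists_forall_eq_natDegree_mul {P : L[X]} (hP : P.Monic) (hdeg : 2 ≤ P.natDegree)
    (hP0 : P.coeff 0 = 0)
    (hcoeff : ∀ i < P.natDegree, ∀ c : ℝ, w (P.coeff i) = (c : WithTop ℝ) → 1 ≤ c)
    {α : ℕ → L} (hα : ∀ n, P.eval (α (n + 1)) = α n) {t : ℕ → ℝ}
    (ht : ∀ n, w (α n) = (t n : WithTop ℝ)) (ht0 : t 0 ≠ 0) :
    (∀ n, t n ≠ 0) ∧ ∃ N, ∀ n ≥ N, t n = P.natDegree * t (n + 1) := by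
  set q := P.natDegree
  have hq : (2 : ℝ) ≤ q := by exact_mod_cast hdeg
  have hone : ∀ (i : ℕ) (c : ℝ), w (P.coeff i) = (c : WithTop ℝ) → (1 : ℝ) ≤ i := by
    intro i c hc
    have : i ≠ 0 := by
      rintro rfl
      rw [hP0, w.map_zero] at hc
      exact WithTop.coe_ne_top hc.symm
    exact_mod_cast Nat.one_le_iff_ne_zero.mpr this
  have hstep : ∀ n, (q - 1) * t (n + 1) < 1 → t n = q * t (n + 1) := by
    intro n hn
    have := w.map_eval_eq_of_forall_lt hP (ht (n + 1)) fun i hi c hc => by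
      have h1 := hcoeff i hi c hc
      have hi1 := hone i c hc
      have hiq : (i : ℝ) ≤ q := by exact_mod_cast hi.le
      rcases le_total 0 (t (n + 1)) with h | h <;> nlinarith
    rw [hα, ht] at this
    exact_mod_cast this
  have hlow : ∀ n, 0 ≤ t (n + 1) → min (q * t (n + 1)) (1 + t (n + 1)) ≤ t n := by
    intro n hn
    have := w.le_map_eval hP (ht (n + 1)) (min_le_left _ (1 + t (n + 1))) fun i hi c hc => by
      refine (min_le_right _ _).trans (add_le_add (hcoeff i hi c hc) ?_)
      have hi1 := hone i c hc
      nlinarith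
    rw [hα, ht] at this
    exact_mod_cast this
  rcases ht0.lt_or_gt with hneg | hpos
  · have hall : ∀ n, t n < 0 := by
      intro n
      induction n with
      | zero => exact hneg
      | succ n ih =>
        by_contra! h
        have := hlow n h
        have : 0 ≤ min (q * t (n + 1)) (1 + t (n + 1)) := le_min (by positivity) (by positivity)
        linarith
    exact ⟨fun n => (hall n).ne, 0, fun n _ => hstep n (by nlinarith [hall (n + 1)])⟩
  · have hall : ∀ n, 0 < t n := by
      intro n
      induction n with
      | zero => exact hpos
      | succ n ih =>
        by_contra! h
        have := hstep n (by nlinarith)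
        nlinarith
    refine ⟨fun n => (hall n).ne', ?_⟩
    have hdecr : ∀ n, (q - 1) * t (n + 1) < 1 ∨ t (n + 1) + 1 ≤ t n := by
      intro n
      by_contra! h
      have := hlow n (hall (n + 1)).le
      rcases min_le_iff.mp this with h' | h' <;> linarith
    obtain ⟨N, hN⟩ : ∃ N, (q - 1) * t (N + 1) < 1 := by
      by_contra! h
      have hsum : ∀ n : ℕ, t n + n ≤ t 0 := by
        intro n
        induction n with
        | zero => simp
        | succ n ih =>
          push_cast
          linarith [(hdecr n).resolve_left (h n).not_gt]
      obtain ⟨n, hn⟩ := exists_nat_gt (t 0)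
      linarith [hsum n, hall n]
    refine ⟨N, fun n hn => hstep n ?_⟩
    induction n, hn using Nat.le_induction with
    | base => exact hN
    | succ n hn ih =>
      rcases hdecr (n + 1) with h | h
      · exact h
      · nlinarith

/-- Adjoining a preimage `b` of `a` under a monic polynomial over `K` does not shrink the value
group, and it multiplies the ramification index by at most the degree. -/
theorem exists_valueGroup_adjoin_eq {P : K[X]} (hP : P.Monic) (hdeg : P.natDegree ≠ 0) {a b : L}
    (hab : aeval b P = a) {c : ℝ} (hc : 0 < c)
    (hG : w.valueGroup K⟮a⟯ = AddSubgroup.zmultiples c⁻¹) :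
    ∃ m : ℕ, 1 ≤ m ∧ m ≤ P.natDegree ∧
      w.valueGroup K⟮b⟯ = AddSubgroup.zmultiples (m * c)⁻¹ := by
  have hle : K⟮a⟯ ≤ K⟮b⟯ := by
    rw [adjoin_simple_le_iff, ← hab]
    exact algebra_adjoin_le_adjoin K {b} (aeval_mem_adjoin_singleton K b)
  have hmem : c⁻¹ ∈ w.valueGroup K⟮b⟯ := by
    have : c⁻¹ ∈ w.valueGroup K⟮a⟯ := hG ▸ AddSubgroup.mem_zmultiples _
    obtain ⟨x, hx, h⟩ := this
    exact ⟨x, hle hx, h⟩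
  set a' : K⟮a⟯ := AdjoinSimple.gen K a
  set f : K⟮a⟯[X] := P.map (algebraMap K K⟮a⟯) - C a'
  have hPm : (P.map (algebraMap K K⟮a⟯)).Monic := hP.map _
  have hf : f.Monic := hPm.sub_of_left <| degree_C_le.trans_lt <| by
    rw [degree_eq_natDegree hPm.ne_zero, natDegree_map]
    exact_mod_cast Nat.pos_of_ne_zero hdeg
  have hfdeg : f.natDegree = P.natDegree := by rw [natDegree_sub_C, natDegree_map]
  have hroot : aeval b f = 0 := by
    rw [_root_.map_sub, aeval_map_algebraMap, hab, aeval_C, AdjoinSimple.algebraMap_gen, sub_self]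
  obtain ⟨m, hm, hmq, h⟩ := AddSubgroup.exists_eq_zmultiples_div (inv_pos.mpr hc) hmem
    (q := P.natDegree) (by
      rintro y ⟨x, hx, hx0, hxy⟩
      rw [← hfdeg, ← hG]
      refine w.exists_nsmul_mem_valueGroup_of_mem_adjoin hf hroot ?_ hx0 hxy
      have : K⟮b⟯ ≤ (K⟮a⟯⟮b⟯).restrictScalars K := by
        rw [adjoin_simple_le_iff]
        exact mem_adjoin_simple_self K⟮a⟯ b
      exact this hx)
  exact ⟨m, hm, hmq, by rw [h, mul_inv, div_eq_mul_inv, mul_comm]⟩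

end AddValuation

/-- The sequence `d_n = w_n (α n)` is eventually constant, where `w_n` is the normalized
discrete valuation of `K_n = K(α n)` (the unique rescaling of `v` on `K_n` whose value
group is exactly `ℤ`). -/
theorem stmt_9 (p r : ℕ) (hp : p.Prime) (hr : 1 ≤ r) (q : ℕ) (hq : q = p ^ r)
    (K : Type) [Field K] [CharZero K]
    (L : Type) [Field L] [Algebra K L] [IsAlgClosure K L]
    (v : L → WithTop ℝ)
    (hv0 : ∀ x : L, v x = ⊤ ↔ x = 0)
    (hvmul : ∀ x y : L, v (x * y) = v x + v y)
    (hvadd : ∀ x y : L, min (v x) (v y) ≤ v (x + y))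
    (hdisc : ∀ x : K, x ≠ 0 → ∃ m : ℤ, v (algebraMap K L x) = ((m : ℝ) : WithTop ℝ))
    (hsurj : ∀ m : ℤ, ∃ x : K, v (algebraMap K L x) = ((m : ℝ) : WithTop ℝ))
    (hcomplete : ∀ f : ℕ → K,
      (∀ C : ℝ, ∃ N : ℕ, ∀ m ≥ N, ∀ n ≥ N,
        ((C : ℝ) : WithTop ℝ) < v (algebraMap K L (f m - f n))) →
      ∃ x : K, ∀ C : ℝ, ∃ N : ℕ, ∀ n ≥ N,
        ((C : ℝ) : WithTop ℝ) < v (algebraMap K L (f n - x)))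
    (hresp : 0 < v ((p : L)))
    (hperf : ∀ x : K, 0 ≤ v (algebraMap K L x) →
      ∃ y : K, 0 ≤ v (algebraMap K L y) ∧ 0 < v (algebraMap K L (x - y ^ p)))
    (P : Polynomial L) (hmonic : P.Monic) (hdeg : P.natDegree = q)
    (hP0 : P.coeff 0 = 0)
    (hPK : ∀ i, ∃ c : K, 0 ≤ v (algebraMap K L c) ∧ P.coeff i = algebraMap K L c)
    (hPred : ∀ i < q, 0 < v (P.coeff i))
    (α : ℕ → L) (α₀ : K) (hα0 : α 0 = algebraMap K L α₀)
    (hbranch : ∀ n : ℕ, 1 ≤ n → P.eval (α n) = α (n - 1))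
    (hv0α : v (α 0) ≠ 0) (hαne : ∀ n, α n ≠ 0) :
    ∃ N : ℕ, ∃ d : ℤ, ∀ n : ℕ, N ≤ n →
      -- for any rescaling constant `c > 0` carrying the value group of `K_n = K(α n)`
      -- onto `ℤ` (i.e. for the normalized valuation `w_n = c • v` of `K_n`),
      -- we have `w_n (α n) = d`
      ∀ c : ℝ, 0 < c →
        ((fun t : ℝ => c * t) ''
            {y : ℝ | ∃ x ∈ IntermediateField.adjoin K {α n}, x ≠ 0 ∧
              v x = (y : WithTop ℝ)} = Set.range ((↑) : ℤ → ℝ)) →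
        ∃ y : ℝ, v (α n) = (y : WithTop ℝ) ∧ c * y = (d : ℝ) := by
  obtain ⟨w, hw⟩ : ∃ w : AddValuation L (WithTop ℝ), ∀ x, w x = v x := by
    have h0 : v 0 = ⊤ := (hv0 0).mpr rfl
    have h1 : v 1 = 0 := by
      have h := hvmul 1 1
      obtain ⟨s, hs⟩ := WithTop.ne_top_iff_exists.mp (mt (hv0 1).mp one_ne_zero)
      rw [mul_one, ← hs] at h
      norm_cast at h
      rw [← hs]
      exact_mod_cast (by linarith : s = 0)
    exact ⟨AddValuation.of v h0 h1 hvadd hvmul, fun _ => rfl⟩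
  simp only [← hw] at *
  have hdeg2 : 2 ≤ P.natDegree := by
    rw [hdeg, hq]
    exact hp.two_le.trans (Nat.le_self_pow (by omega) p)
  obtain ⟨Q, hQ, hQdeg, hQm⟩ := lifts_and_natDegree_eq_and_monic
    ((lifts_iff_coeff_lifts P).mpr fun i => (hPK i).imp fun c hc => hc.2.symm) hmonic
  have hcoeff : ∀ i < P.natDegree, ∀ c : ℝ, w (P.coeff i) = (c : WithTop ℝ) → 1 ≤ c := by
    intro i hi c hc
    have hpos := hPred i (hdeg ▸ hi)
    obtain ⟨x, -, hx⟩ := hPK i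
    have hx0 : x ≠ 0 := by
      rintro rfl
      rw [hx, map_zero, w.map_zero] at hc
      exact WithTop.coe_ne_top hc.symm
    obtain ⟨m, hm⟩ := hdisc x hx0
    rw [← hx, hc] at hm
    rw [hc] at hpos
    norm_cast at hm hpos
    rw [hm] at hpos ⊢
    norm_cast at hpos ⊢
  have hα : ∀ n, P.eval (α (n + 1)) = α n := fun n => hbranch (n + 1) (by omega)
  choose t ht using fun n => w.exists_coe_eq (hαne n)
  obtain ⟨htne, N, hN⟩ := w.exists_forall_eq_natDegree_mul hmonic hdeg2 hP0 hcoeff hα ht (by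
    intro h
    rw [ht, h] at hv0α
    exact hv0α rfl)
  have hgroup : ∀ n (c : ℝ), 0 < c → w.valueGroup K⟮α n⟯ = AddSubgroup.zmultiples c⁻¹ →
      ∃ m : ℕ, 1 ≤ m ∧ m ≤ P.natDegree ∧
        w.valueGroup K⟮α (n + 1)⟯ = AddSubgroup.zmultiples (m * c)⁻¹ := by
    intro n c hc hG
    rw [← hQdeg]
    refine w.exists_valueGroup_adjoin_eq hQm (by omega) ?_ hc hG
    rw [← hα n, ← hQ, eval_map_algebraMap]
  have hgroup0 : w.valueGroup K⟮α 0⟯ = AddSubgroup.zmultiples (1 : ℝ)⁻¹ := by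
    have hbot : K⟮α 0⟯ = ⊥ := by
      rw [adjoin_simple_eq_bot_iff, hα0]
      exact IntermediateField.algebraMap_mem _ α₀
    ext y
    rw [w.mem_valueGroup, hbot, inv_one, AddSubgroup.mem_zmultiples_iff]
    constructor
    · rintro ⟨x, hx, hx0, hxy⟩
      obtain ⟨z, rfl⟩ := mem_bot.mp hx
      obtain ⟨m, hm⟩ := hdisc z (by rintro rfl; simp at hx0)
      rw [hxy] at hm
      norm_cast at hm
      exact ⟨m, by simp [hm]⟩
    · rintro ⟨m, rfl⟩
      obtain ⟨x, hx⟩ := hsurj m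
      refine ⟨algebraMap K L x, IntermediateField.algebraMap_mem _ x, ?_, by simpa using hx⟩
      rw [← w.ne_top_iff, hx]
      exact WithTop.coe_ne_top
  have hex : ∀ n, ∃ c : ℝ, 0 < c ∧ w.valueGroup K⟮α n⟯ = AddSubgroup.zmultiples c⁻¹ := by
    intro n
    induction n with
    | zero => exact ⟨1, one_pos, hgroup0⟩
    | succ n ih =>
      obtain ⟨c, hc, hG⟩ := ih
      obtain ⟨m, hm, -, hG'⟩ := hgroup n c hc hG
      have : (0 : ℝ) < m := by exact_mod_cast hm
      exact ⟨m * c, by positivity, hG'⟩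
  choose e he heG using hex
  have huniq : ∀ n (c : ℝ), 0 < c → ((fun t : ℝ => c * t) ''
      (w.valueGroup K⟮α n⟯ : Set ℝ) = Set.range ((↑) : ℤ → ℝ)) → c = e n := by
    intro n c hc h
    rw [heG n] at h
    exact AddSubgroup.eq_of_image_zmultiples_inv (he n) hc h
  have hdint : ∀ n, ∃ d : ℤ, e n * t n = d := by
    intro n
    obtain ⟨d, hd⟩ : t n ∈ AddSubgroup.zmultiples (e n)⁻¹ :=
      heG n ▸ ⟨α n, mem_adjoin_simple_self K (α n), hαne n, ht n⟩
    refine ⟨d, ?_⟩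
    simp only [zsmul_eq_mul] at hd
    rw [← hd]
    field_simp [(he n).ne']
  choose d hd using hdint
  obtain ⟨M, -, D, hD⟩ := Int.exists_eventually_const_of_mul_eq (d := d) (q := P.natDegree) (N := N)
    (by
      intro n hn
      obtain ⟨m, hm, hmq, hG⟩ := hgroup n (e n) (he n) (heG n)
      have hm' : (0 : ℝ) < m := by exact_mod_cast hm
      have hem : m * e n = e (n + 1) := by
        have hpos : 0 < (m * e n)⁻¹ := inv_pos.mpr (mul_pos hm' (he n))
        rcases (AddSubgroup.zmultiples_eq_zmultiples_iff
          (not_isOfFinAddOrder_of_isAddTorsionFree hpos.ne')).mp (hG.symm.trans (heG (n + 1)))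
          with h | h
        · exact inv_injective h
        · linarith [inv_pos.mpr (he (n + 1))]
      refine ⟨m, hm, hmq, ?_⟩
      have : (P.natDegree : ℝ) * d (n + 1) = m * d n := by
        rw [← hd, ← hd, hN n hn, ← hem]
        ring
      exact_mod_cast this)
  refine ⟨M, D, fun n hn c hc h => ⟨t n, ht n, ?_⟩⟩
  rw [huniq n c hc h, hd, hD n hn]
end

section
/- Let α ∈ L with 0 < |v(α)| ≤ 1/q, and let Q(X) = P(X + α) − P(α), with coefficients Q_i. Then for every 1 ≤ i ≤ q, v(Q_i) = min over i ≤ j ≤ q of { v(p)·v_p(C(j, i)) + v(P_j) + (j − i)·v(α) } (terms with P_j = 0 interpreted as ∞), and this minimum is attained at a unique index j. In particular Q_1 ≠ 0. -/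
open Polynomial in
theorem Polynomial.taylor_coeff_eq_sum_Icc {R : Type*} [CommSemiring R] (P : R[X]) (r : R)
    (i : ℕ) :
    (taylor r P).coeff i =
      ∑ j ∈ Finset.Icc i P.natDegree, (j.choose i : R) * P.coeff j * r ^ (j - i) := by
  rw [taylor_coeff, hasseDeriv_apply, sum_over_range _ (by simp), eval_finsetSum]
  simp only [eval_monomial]
  refine (Finset.sum_subset (fun j hj => ?_) fun j _ hj' => ?_).symm
  · rw [Finset.mem_Icc] at hj
    exact Finset.mem_range.mpr (by lia)
  · rw [Nat.choose_eq_zero_of_lt (by simp_all)]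
    simp

theorem AddValuation.map_sum_eq_of_forall_lt {R Γ ι : Type*} [Ring R]
    [LinearOrderedAddCommMonoidWithTop Γ] (v : AddValuation R Γ) {s : Finset ι}
    {f : ι → R} {k : ι} (hk : k ∈ s) (hfin : v (f k) ≠ ⊤)
    (hlt : ∀ j ∈ s, j ≠ k → v (f k) < v (f j)) :
    v (∑ j ∈ s, f j) = v (f k) := by
  classical
  rw [← Finset.add_sum_erase s f hk]
  refine v.map_add_eq_of_lt_left (v.map_lt_sum hfin fun j hj => ?_)
  exact hlt j (Finset.mem_of_mem_erase hj) (Finset.ne_of_mem_erase hj)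

theorem eq_of_int_add_natCast_mul_eq {q j k : ℕ} {a : ℝ} {m n : ℤ} (ha0 : a ≠ 0)
    (haq : |a| ≤ 1 / q) (hjk : |(j : ℝ) - k| < q)
    (h : (m : ℝ) + j * a = n + k * a) : j = k := by
  have hq : (0 : ℝ) < q := (abs_nonneg _).trans_lt hjk
  have hnm : ((n - m : ℤ) : ℝ) = (j - k) * a := by push_cast; linarith
  have hlt : |((n - m : ℤ) : ℝ)| < 1 := by
    rw [hnm, abs_mul]
    calc |(j : ℝ) - k| * |a| < q * |a| := by
          gcongr
      _ ≤ q * (1 / q) := by gcongr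
      _ = 1 := by field_simp
  have hz : n - m = 0 := Int.abs_lt_one_iff.mp (by exact_mod_cast hlt)
  rw [hz, Int.cast_zero, eq_comm, mul_eq_zero, or_iff_left ha0, sub_eq_zero] at hnm
  exact_mod_cast hnm


/-- For `0 < |v(α)| ≤ 1/q` and `Q(X) = P(X + α) - P(α)`, the valuation of `Q_i`
(for `1 ≤ i ≤ q`) equals the minimum over `i ≤ j ≤ q` of
`v(p)·v_p(C(j,i)) + v(P_j) + (j - i)·v(α)`, the minimum is attained at a unique index,
and in particular `Q_1 ≠ 0`. -/
theorem stmt_10 (p r : ℕ) (hp : p.Prime) (hr : 1 ≤ r) (q : ℕ) (hq : q = p ^ r)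
    (L : Type) [Field L] [CharZero L]
    (v : L → WithTop ℝ)
    (hv0 : ∀ x : L, v x = ⊤ ↔ x = 0)
    (hvmul : ∀ x y : L, v (x * y) = v x + v y)
    (hvadd : ∀ x y : L, min (v x) (v y) ≤ v (x + y))
    (vp : ℕ) (hvp : 0 < vp)
    (hvint : ∀ m : ℤ, m ≠ 0 →
      v ((m : L)) = (((vp : ℝ) * (padicValInt p m : ℝ) : ℝ) : WithTop ℝ))
    (P : Polynomial L) (hmonic : P.Monic) (hdeg : P.natDegree = q)
    (hP0 : P.coeff 0 = 0)
    (hPZ : ∀ i, P.coeff i = 0 ∨ ∃ m : ℤ, v (P.coeff i) = ((m : ℝ) : WithTop ℝ))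
    (α : L) (a : ℝ) (hva : v α = (a : WithTop ℝ)) (ha0 : a ≠ 0) (haq : |a| ≤ 1 / q)
    (Q : Polynomial L)
    (hQ : Q = P.comp (Polynomial.X + Polynomial.C α) - Polynomial.C (P.eval α)) :
    (∀ (i : ℕ) (hi1 : 1 ≤ i) (hiq : i ≤ q),
      v (Q.coeff i) =
        (Finset.Icc i q).inf' (Finset.nonempty_Icc.mpr hiq)
          (fun j => (((vp : ℝ) * (padicValNat p (j.choose i) : ℝ) +
              ((j : ℝ) - (i : ℝ)) * a : ℝ) : WithTop ℝ) + v (P.coeff j)) ∧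
      ∃! j : ℕ, j ∈ Finset.Icc i q ∧
        (((vp : ℝ) * (padicValNat p (j.choose i) : ℝ) +
            ((j : ℝ) - (i : ℝ)) * a : ℝ) : WithTop ℝ) + v (P.coeff j) = v (Q.coeff i)) ∧
    Q.coeff 1 ≠ 0 := by
  let w : AddValuation L (WithTop ℝ) := AddValuation.of v ((hv0 0).mpr rfl)
    (by simpa using hvint 1 one_ne_zero) hvadd hvmul
  have hwv (x : L) : w x = v x := rfl
  have hval (i : ℕ) (j : ℕ) (hj : i ≤ j) :
      w ((j.choose i : L) * P.coeff j * α ^ (j - i)) =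
        (((vp : ℝ) * (padicValNat p (j.choose i) : ℝ) + ((j : ℝ) - (i : ℝ)) * a : ℝ) :
          WithTop ℝ) + v (P.coeff j) := by
    have hc := hvint (j.choose i) (by exact_mod_cast (Nat.choose_pos hj).ne')
    rw [padicValInt.of_nat, Int.cast_natCast] at hc
    have hpow : w (α ^ (j - i)) = ((((j : ℝ) - (i : ℝ)) * a : ℝ) : WithTop ℝ) := by
      rw [w.map_pow, hwv, hva, ← WithTop.coe_nsmul, nsmul_eq_mul, Nat.cast_sub hj]
    rw [w.map_mul, w.map_mul, hpow, hwv, hwv, hc, WithTop.coe_add]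
    exact add_right_comm _ _ _
  have hcoeff (i : ℕ) (hi : 1 ≤ i) : Q.coeff i =
      ∑ j ∈ Finset.Icc i q, (j.choose i : L) * P.coeff j * α ^ (j - i) := by
    rw [hQ, ← Polynomial.taylor_apply, Polynomial.coeff_sub, Polynomial.coeff_C_of_ne_zero (by lia),
      sub_zero, Polynomial.taylor_coeff_eq_sum_Icc, hdeg]
  have key (i : ℕ) (hi1 : 1 ≤ i) (hiq : i ≤ q) :
      ∃ k ∈ Finset.Icc i q, w (Q.coeff i) ≠ ⊤ ∧
        w (Q.coeff i) = w ((k.choose i : L) * P.coeff k * α ^ (k - i)) ∧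
        ∀ j ∈ Finset.Icc i q, j ≠ k →
          w (Q.coeff i) < w ((j.choose i : L) * P.coeff j * α ^ (j - i)) := by
    set f : ℕ → L := fun j => (j.choose i : L) * P.coeff j * α ^ (j - i) with hf
    obtain ⟨k, hk, hmin⟩ := (Finset.Icc i q).exists_min_image (fun j => w (f j))
      (Finset.nonempty_Icc.mpr hiq)
    have hα : α ≠ 0 := fun h => by simp [(hv0 α).mpr h] at hva
    have hfq : f q ≠ 0 := by
      have hPq : P.coeff q = 1 := hdeg ▸ hmonic.coeff_natDegree
      simp only [hf, hPq, mul_one]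
      exact mul_ne_zero (Nat.cast_ne_zero.mpr (Nat.choose_pos hiq).ne') (pow_ne_zero _ hα)
    have hfin : w (f k) ≠ ⊤ := ne_top_of_le_ne_top (mt (hv0 _).mp hfq)
      (hmin q (Finset.right_mem_Icc.mpr hiq))
    have hinj (j : ℕ) (hj : j ∈ Finset.Icc i q) (hjk : w (f k) = w (f j)) : j = k := by
      have hcoeff_ne (l : ℕ) (hl : w (f l) ≠ ⊤) : P.coeff l ≠ 0 := fun h0 =>
        hl ((hv0 _).mpr (by simp [hf, h0]))
      obtain ⟨m, hm⟩ := (hPZ j).resolve_left (hcoeff_ne j (hjk ▸ hfin))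
      obtain ⟨n, hn⟩ := (hPZ k).resolve_left (hcoeff_ne k hfin)
      rw [Finset.mem_Icc] at hj hk
      rw [hval i k hk.1, hval i j hj.1, hm, hn, ← WithTop.coe_add, ← WithTop.coe_add,
        WithTop.coe_inj] at hjk
      refine eq_of_int_add_natCast_mul_eq (m := vp * padicValNat p (j.choose i) + m)
        (n := vp * padicValNat p (k.choose i) + n) ha0 haq ?_ ?_
      · have h1 : (1 : ℝ) ≤ j := by exact_mod_cast hi1.trans hj.1
        have h2 : (1 : ℝ) ≤ k := by exact_mod_cast hi1.trans hk.1
        have h3 : (j : ℝ) ≤ q := by exact_mod_cast hj.2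
        have h4 : (k : ℝ) ≤ q := by exact_mod_cast hk.2
        rw [abs_lt]
        constructor <;> linarith
      · simp only [Int.cast_add, Int.cast_mul, Int.cast_natCast]
        linarith
    have hlt (j : ℕ) (hj : j ∈ Finset.Icc i q) (hjk : j ≠ k) : w (f k) < w (f j) :=
      (hmin j hj).lt_of_ne (mt (hinj j hj) hjk)
    have hsum : w (Q.coeff i) = w (f k) := by
      rw [hcoeff i hi1]
      exact w.map_sum_eq_of_forall_lt hk hfin hlt
    exact ⟨k, hk, hsum ▸ hfin, hsum, hsum ▸ hlt⟩
  have hq1 : 1 ≤ q := hq ▸ Nat.one_le_pow _ _ hp.pos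
  refine ⟨fun i hi1 hiq => ?_, fun h0 => ?_⟩
  · obtain ⟨k, hk, -, heq, hlt⟩ := key i hi1 hiq
    rw [hval i k (Finset.mem_Icc.mp hk).1] at heq
    refine ⟨le_antisymm (Finset.le_inf' _ _ fun j hj => ?_) ?_, k, ⟨hk, heq.symm⟩, ?_⟩
    · rcases eq_or_ne j k with rfl | hjk
      · exact heq.le
      · exact hval i j (Finset.mem_Icc.mp hj).1 ▸ (hlt j hj hjk).le
    · exact (Finset.inf'_le _ hk).trans heq.ge
    · rintro j ⟨hj, hje⟩
      by_contra hjk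
      have := hlt j hj hjk
      rw [hval i j (Finset.mem_Icc.mp hj).1, hje] at this
      exact this.ne rfl
  · obtain ⟨k, -, hne, -⟩ := key 1 le_rfl hq1
    exact hne ((hv0 _).mpr h0)
end

section
/- Let α ∈ L with 0 < |v(α)| ≤ 1/q, and let Q(X) = P(X + α) − P(α), with coefficients Q_i. Then for every 0 ≤ k ≤ r − 1 and every integer i with p^k ≤ i < p^{k+1}, one has v(Q_i) ≥ v(Q_{p^k}) + (p^k − i)·v(α). (Consequently, the Newton polygon of Q can only have vertices whose x-coordinates are powers of p.) -/
/-- If the leading base-`p` digit of `i` is at place `k`, then `p` does not divide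
`i.choose (p ^ k)`. -/
theorem Nat.Prime.not_dvd_choose_pow_of_lt {p : ℕ} (hp : p.Prime) {k i : ℕ}
    (hki : p ^ k ≤ i) (hik : i < p ^ (k + 1)) : ¬ p ∣ i.choose (p ^ k) := by
  have : Fact p.Prime := ⟨hp⟩
  induction k generalizing i with
  | zero =>
    rw [pow_zero, Nat.choose_one_right]
    exact Nat.not_dvd_of_pos_of_lt (lt_of_lt_of_le (pow_pos hp.pos 0) hki)
      (by simpa using hik)
  | succ k ih =>
    have hlucas := Choose.choose_modEq_choose_mod_mul_choose_div_nat
      (n := i) (k := p ^ (k + 1)) (p := p)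
    rw [pow_succ, Nat.mul_mod_left, Nat.choose_zero_right, one_mul,
      Nat.mul_div_cancel _ hp.pos] at hlucas
    rw [pow_succ, hlucas.dvd_iff dvd_rfl]
    refine ih ((Nat.le_div_iff_mul_le hp.pos).2 (by rwa [← pow_succ])) ?_
    exact Nat.div_lt_of_lt_mul (by rwa [← pow_succ'])

/-- If the nonzero terms of a finite sum have pairwise distinct valuations, no term has valuation
smaller than the sum. -/
theorem AddValuation.map_sum_le_of_injOn {R Γ ι : Type*} [Ring R]
    [LinearOrderedAddCommMonoidWithTop Γ] (v : AddValuation R Γ) {s : Finset ι} {f : ι → R}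
    (hf : ∀ i ∈ s, ∀ j ∈ s, v (f i) = v (f j) → v (f i) ≠ ⊤ → i = j) {j : ι} (hj : j ∈ s) :
    v (∑ i ∈ s, f i) ≤ v (f j) := by
  classical
  obtain ⟨m, hm, hmin⟩ := s.exists_min_image (fun i => v (f i)) ⟨j, hj⟩
  by_cases htop : v (f m) = ⊤
  · exact le_top.trans (htop ▸ hmin j hj)
  · have hlt : v (f m) < v (∑ i ∈ s.erase m, f i) := by
      refine v.map_lt_sum htop fun i hi => ?_
      have his := Finset.mem_of_mem_erase hi
      exact (hmin i his).lt_of_ne fun h => Finset.ne_of_mem_erase hi (hf m hm i his h htop).symm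
    rw [← Finset.add_sum_erase s f hm, v.map_add_eq_of_lt_left hlt]
    exact hmin j hj

theorem Polynomial.coeff_comp_X_add_C {R : Type*} [CommSemiring R] (P : Polynomial R) (α : R)
    (i : ℕ) :
    (P.comp (Polynomial.X + Polynomial.C α)).coeff i =
      ∑ j ∈ Finset.range (P.natDegree + 1), (j.choose i : R) * P.coeff j * α ^ (j - i) := by
  rw [← taylor_apply, taylor_coeff, hasseDeriv_apply,
    Polynomial.sum_over_range _ (by simp), eval_finsetSum]
  simp

/-- If `0 < |a| ≤ 1 / q`, the multiples `a, 2 * a, …, q * a` are pairwise incongruent modulo `1`. -/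
theorem eq_of_int_add_mul_eq {q : ℕ} {a : ℝ} (ha0 : a ≠ 0) (haq : |a| ≤ 1 / q) {m n : ℤ} {j l : ℕ}
    (hj0 : 0 < j) (hl0 : 0 < l) (hj : j ≤ q) (hl : l ≤ q)
    (h : (m : ℝ) + j * a = n + l * a) : j = l := by
  have hq : (0 : ℝ) < q := by exact_mod_cast hj0.trans_le hj
  have habs : |(j : ℝ) - l| < q := by
    have h1 : (1 : ℝ) ≤ j := by exact_mod_cast hj0
    have h2 : (1 : ℝ) ≤ l := by exact_mod_cast hl0
    have h3 : (j : ℝ) ≤ q := by exact_mod_cast hj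
    have h4 : (l : ℝ) ≤ q := by exact_mod_cast hl
    rw [abs_lt]
    constructor <;> linarith
  have hmul : ((n - m : ℤ) : ℝ) = (j - l) * a := by
    push_cast
    linarith
  have hlt : |((n - m : ℤ) : ℝ)| < 1 := by
    rw [hmul, abs_mul]
    calc |(j : ℝ) - l| * |a| < q * |a| := by gcongr
      _ ≤ q * (1 / q) := by gcongr
      _ = 1 := by field_simp
  have hzero : n - m = 0 := Int.abs_lt_one_iff.1 (by exact_mod_cast hlt)
  rw [hzero, Int.cast_zero, eq_comm, mul_eq_zero, or_iff_left ha0, sub_eq_zero] at hmul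
  exact_mod_cast hmul


/-- For `0 < |v(α)| ≤ 1/q` and `Q(X) = P(X + α) - P(α)`: for every `0 ≤ k ≤ r - 1` and
every `i` with `p^k ≤ i < p^(k+1)`, `v(Q_i) ≥ v(Q_{p^k}) + (p^k - i)·v(α)`; hence the
Newton polygon of `Q` can only have vertices over powers of `p`. -/
theorem stmt_11 (p r : ℕ) (hp : p.Prime) (hr : 1 ≤ r) (q : ℕ) (hq : q = p ^ r)
    (L : Type) [Field L] [CharZero L]
    (v : L → WithTop ℝ)
    (hv0 : ∀ x : L, v x = ⊤ ↔ x = 0)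
    (hvmul : ∀ x y : L, v (x * y) = v x + v y)
    (hvadd : ∀ x y : L, min (v x) (v y) ≤ v (x + y))
    (vp : ℕ) (hvp : 0 < vp)
    (hvint : ∀ m : ℤ, m ≠ 0 →
      v ((m : L)) = (((vp : ℝ) * (padicValInt p m : ℝ) : ℝ) : WithTop ℝ))
    (P : Polynomial L) (hmonic : P.Monic) (hdeg : P.natDegree = q)
    (hP0 : P.coeff 0 = 0)
    (hPZ : ∀ i, P.coeff i = 0 ∨ ∃ m : ℤ, v (P.coeff i) = ((m : ℝ) : WithTop ℝ))
    (α : L) (a : ℝ) (hva : v α = (a : WithTop ℝ)) (ha0 : a ≠ 0) (haq : |a| ≤ 1 / q)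
    (Q : Polynomial L)
    (hQ : Q = P.comp (Polynomial.X + Polynomial.C α) - Polynomial.C (P.eval α)) :
    ∀ k : ℕ, k ≤ r - 1 → ∀ i : ℕ, p ^ k ≤ i → i < p ^ (k + 1) →
      v (Q.coeff (p ^ k)) + ((((p : ℝ) ^ k - (i : ℝ)) * a : ℝ) : WithTop ℝ) ≤
        v (Q.coeff i) := by
  intro k hk i hki hik
  have hv1 : v 1 = 0 := by simpa using hvint 1 one_ne_zero
  let w : AddValuation L (WithTop ℝ) := AddValuation.of v ((hv0 0).2 rfl) hv1 hvadd hvmul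
  have hwv : ∀ x, w x = v x := fun _ => rfl
  have hα (n : ℕ) : v (α ^ n) = ((n * a : ℝ) : WithTop ℝ) := by
    rw [← hwv, w.map_pow, hwv, hva, ← WithTop.coe_nsmul, nsmul_eq_mul]
  have hvnat (n : ℕ) (hn : n ≠ 0) :
      v (n : L) = (((vp : ℝ) * (padicValNat p n : ℝ) : ℝ) : WithTop ℝ) := by
    have := hvint n (by exact_mod_cast hn)
    rwa [Int.cast_natCast, padicValInt.of_nat] at this
  have hvnonneg (n : ℕ) : 0 ≤ v (n : L) := by
    rcases eq_or_ne n 0 with rfl | hn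
    · simp [(hv0 0).2 rfl]
    · rw [hvnat n hn]
      exact_mod_cast (by positivity : (0 : ℝ) ≤ vp * padicValNat p n)
  have hcoeff (n : ℕ) (hn : 0 < n) : Q.coeff n =
      ∑ j ∈ Finset.range (P.natDegree + 1), (j.choose n : L) * P.coeff j * α ^ (j - n) := by
    rw [hQ, Polynomial.coeff_sub, Polynomial.coeff_comp_X_add_C,
      Polynomial.coeff_C_of_ne_zero hn.ne', sub_zero]
  have hpk : 0 < p ^ k := pow_pos hp.pos k
  have hterm (j : ℕ) (hj : p ^ k ≤ j) (hPj : P.coeff j ≠ 0) : ∃ m : ℤ,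
      v ((j.choose (p ^ k) : L) * P.coeff j * α ^ (j - p ^ k)) =
        ((m + j * a - (p : ℝ) ^ k * a : ℝ) : WithTop ℝ) := by
    obtain ⟨m, hm⟩ := (hPZ j).resolve_left hPj
    refine ⟨vp * padicValNat p (j.choose (p ^ k)) + m, ?_⟩
    rw [hvmul, hvmul, hα, hm, hvnat _ (Nat.choose_pos hj).ne', ← WithTop.coe_add,
      ← WithTop.coe_add, Nat.cast_sub hj]
    congr 1
    simp only [Int.cast_add, Int.cast_mul, Int.cast_natCast, Nat.cast_pow]
    ring
  have hle (j : ℕ) (hj : j ∈ Finset.range (P.natDegree + 1)) :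
      v (Q.coeff (p ^ k)) ≤ v ((j.choose (p ^ k) : L) * P.coeff j * α ^ (j - p ^ k)) := by
    rw [hcoeff _ hpk]
    refine w.map_sum_le_of_injOn
      (f := fun j => (j.choose (p ^ k) : L) * P.coeff j * α ^ (j - p ^ k)) ?_ hj
    intro j hj l hl heq hne
    have hbounds : ∀ n, w ((n.choose (p ^ k) : L) * P.coeff n * α ^ (n - p ^ k)) ≠ ⊤ →
        p ^ k ≤ n ∧ P.coeff n ≠ 0 := by
      intro n hn
      rw [AddValuation.ne_top_iff] at hn
      refine ⟨not_lt.1 fun h => hn ?_, fun h => hn ?_⟩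
      · rw [Nat.choose_eq_zero_of_lt h, Nat.cast_zero, zero_mul, zero_mul]
      · rw [h, mul_zero, zero_mul]
    obtain ⟨hkj, hPj⟩ := hbounds j hne
    obtain ⟨hkl, hPl⟩ := hbounds l (heq ▸ hne)
    obtain ⟨m, hm⟩ := hterm j hkj hPj
    obtain ⟨n, hn⟩ := hterm l hkl hPl
    rw [hwv, hwv, hm, hn, WithTop.coe_inj] at heq
    rw [Finset.mem_range, hdeg, Nat.lt_succ_iff] at hj hl
    exact eq_of_int_add_mul_eq ha0 haq (hpk.trans_le hkj) (hpk.trans_le hkl) hj hl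
      (sub_left_injective heq)
  have hunit : v ((i.choose (p ^ k) : ℕ) : L) = 0 := by
    rw [hvnat _ (Nat.choose_pos hki).ne',
      padicValNat.eq_zero_of_not_dvd (hp.not_dvd_choose_pow_of_lt hki hik)]
    simp
  rw [hcoeff i (hpk.trans_le hki)]
  refine w.map_le_sum fun j hj => ?_
  rw [hwv]
  rcases lt_or_ge j i with hji | hij
  · rw [Nat.choose_eq_zero_of_lt hji, Nat.cast_zero, zero_mul, zero_mul, (hv0 0).2 rfl]
    exact le_top
  have hchoose : v (j.choose (p ^ k) : L) ≤ v (j.choose i : L) := by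
    have h := congrArg (fun n : ℕ => v (n : L)) (Nat.choose_mul (n := j) hki)
    simp only [Nat.cast_mul, hvmul, hunit, add_zero] at h
    rw [h]
    exact le_add_of_nonneg_right (hvnonneg _)
  calc v (Q.coeff (p ^ k)) + ((((p : ℝ) ^ k - (i : ℝ)) * a : ℝ) : WithTop ℝ)
      ≤ v ((j.choose (p ^ k) : L) * P.coeff j * α ^ (j - p ^ k))
          + ((((p : ℝ) ^ k - (i : ℝ)) * a : ℝ) : WithTop ℝ) := by gcongr; exact hle j hj
    _ = v (j.choose (p ^ k) : L) + v (P.coeff j) + v (α ^ (j - i)) := by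
      rw [hvmul, hvmul, hα, hα, add_assoc, ← WithTop.coe_add, Nat.cast_sub (hki.trans hij),
        Nat.cast_sub hij]
      congr 2
      push_cast
      ring
    _ ≤ v (j.choose i : L) + v (P.coeff j) + v (α ^ (j - i)) := by gcongr
    _ = v ((j.choose i : L) * P.coeff j * α ^ (j - i)) := by rw [hvmul, hvmul]
end

section
/- Let R ∈ L[X] have degree q = p^r and suppose R is post-critically bounded: for every c ∈ L with R'(c) = 0, the set { v(R^n(c)) : n ≥ 1 } is bounded below, where R^n denotes the n-th iterate of R under composition. Then there exist a ∈ L with a ≠ 0 and b ∈ L such that the linear conjugate P(X) = (ℓ^{−1} ∘ R ∘ ℓ)(X), where ℓ(X) = aX + b, is monic, satisfies P(0) = 0, and satisfies v(P_i) + v(i·1_L) ≥ v(q·1_L) for all 1 ≤ i ≤ q; in particular every coefficient of P has nonnegative valuation. -/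
open Polynomial in
theorem AddValuation.le_coeff_prod_X_sub_C {L : Type*} [CommRing L]
    (v : AddValuation L (WithTop ℝ)) (m : ℝ) (s : Multiset L)
    (hs : ∀ c ∈ s, (m : WithTop ℝ) ≤ v c) (i : ℕ) :
    ((((s.card : ℝ) - i) * m : ℝ) : WithTop ℝ) ≤ v ((s.map fun c => X - C c).prod.coeff i) := by
  induction s using Multiset.induction_on generalizing i with
  | empty =>
    rcases Nat.eq_zero_or_pos i with rfl | hi
    · simp
    · simp [coeff_one, hi.ne']
  | cons c s ih =>
    have hs' : ∀ d ∈ s, (m : WithTop ℝ) ≤ v d := fun d hd => hs d (Multiset.mem_cons_of_mem hd)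
    have hconst : ((((s.card + 1 : ℕ) : ℝ) - i) * m : ℝ) ≤
        v (c * (s.map fun c => X - C c).prod.coeff i) := by
      rw [v.map_mul, show ((((s.card + 1 : ℕ) : ℝ) - i) * m : ℝ) = m + ((s.card : ℝ) - i) * m by
        push_cast; ring, WithTop.coe_add]
      exact add_le_add (hs c (Multiset.mem_cons_self c s)) (ih hs' i)
    rw [Multiset.map_cons, Multiset.prod_cons, Multiset.card_cons, sub_mul (X : L[X]), coeff_sub,
      coeff_C_mul]
    refine v.map_le_sub ?_ hconst
    cases i with
    | zero => simp
    | succ k =>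
      rw [coeff_X_mul]
      convert ih hs' k using 2
      push_cast
      ring

open Polynomial in
theorem AddValuation.le_coeff_of_le_criticalPoints {L : Type*} [Field L] [CharZero L]
    [IsAlgClosed L] (v : AddValuation L (WithTop ℝ)) {P : L[X]} (hP : P.Monic) (m : ℝ)
    (hm : ∀ c, P.derivative.eval c = 0 → (m : WithTop ℝ) ≤ v c) {i : ℕ} (hi : 1 ≤ i)
    (hiP : i ≤ P.natDegree) :
    v (P.natDegree : L) + ((((P.natDegree : ℝ) - i) * m : ℝ) : WithTop ℝ) ≤
      v (P.coeff i) + v (i : L) := by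
  obtain ⟨k, rfl⟩ : ∃ k, i = k + 1 := ⟨i - 1, by omega⟩
  obtain ⟨d, hd⟩ : ∃ d, P.natDegree = d + 1 := ⟨P.natDegree - 1, by omega⟩
  have hcoeff : P.derivative.coeff d = (P.natDegree : L) := by
    rw [coeff_derivative, ← hd, hP.coeff_natDegree, hd]
    push_cast
    ring
  have hdeg : P.derivative.natDegree = d := by
    refine le_antisymm ?_ (le_natDegree_of_ne_zero ?_)
    · exact (natDegree_derivative_le P).trans_eq (by rw [hd, Nat.add_sub_cancel])
    · rw [hcoeff, hd]
      exact_mod_cast Nat.succ_ne_zero d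
  have hsplit := IsAlgClosed.splits P.derivative
  have hcard : P.derivative.roots.card = d := by rw [← hsplit.natDegree_eq_card_roots, hdeg]
  have hlead : P.derivative.leadingCoeff = (P.natDegree : L) := by
    rw [leadingCoeff, hdeg, hcoeff]
  have hk : P.coeff (k + 1) * ((k + 1 : ℕ) : L) =
      (P.natDegree : L) * (P.derivative.roots.map fun c => X - C c).prod.coeff k := by
    rw [← hlead, ← coeff_C_mul, ← hsplit.eq_prod_roots, coeff_derivative]
    push_cast
    rfl
  rw [← v.map_mul, hk, v.map_mul]
  gcongr
  have hroots := v.le_coeff_prod_X_sub_C m P.derivative.roots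
    (fun c hc => hm c (isRoot_of_mem_roots hc)) k
  rw [hcard] at hroots
  convert hroots using 2
  rw [hd]
  push_cast
  ring

theorem AddValuation.natCast_nonneg {L : Type*} [Ring L] (v : AddValuation L (WithTop ℝ)) (n : ℕ) :
    0 ≤ v (n : L) := by
  induction n with
  | zero => simp
  | succ n ih =>
    rw [Nat.cast_succ]
    exact v.map_le_add ih v.map_one.ge

theorem AddValuation.intCast_nonneg {L : Type*} [Ring L] (v : AddValuation L (WithTop ℝ)) (n : ℤ) :
    0 ≤ v (n : L) := by
  obtain ⟨n, rfl | rfl⟩ := n.eq_nat_or_neg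
  · simpa using v.natCast_nonneg n
  · simpa [v.map_neg] using v.natCast_nonneg n

theorem AddValuation.natCast_eq_zero_of_coprime {L : Type*} [Ring L]
    (v : AddValuation L (WithTop ℝ)) {p n : ℕ} (hp : 0 < v (p : L)) (h : p.Coprime n) :
    v (n : L) = 0 := by
  refine le_antisymm ?_ (v.natCast_nonneg n)
  by_contra! hn
  have hbezout : (1 : L) = (p : L) * (p.gcdA n : ℤ) + (n : L) * (p.gcdB n : ℤ) := by
    have := Nat.gcd_eq_gcd_ab p n
    rw [Nat.Coprime.gcd_eq_one h] at this
    exact_mod_cast congrArg (Int.cast : ℤ → L) this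
  have : 0 < v (1 : L) := by
    rw [hbezout]
    refine v.map_lt_add ?_ ?_ <;> rw [v.map_mul]
    · exact add_pos_of_pos_of_nonneg hp (v.intCast_nonneg _)
    · exact add_pos_of_pos_of_nonneg hn (v.intCast_nonneg _)
  simp at this

theorem AddValuation.natCast_lt_of_lt_prime_pow {L : Type*} [Field L] [CharZero L]
    (v : AddValuation L (WithTop ℝ)) {p r i : ℕ} (hp : p.Prime) (hvp : 0 < v (p : L))
    (hi : i ≠ 0) (hir : i < p ^ r) : v (i : L) < v ((p ^ r : ℕ) : L) := by
  obtain ⟨e, n, hn, rfl⟩ := Nat.exists_eq_pow_mul_and_not_dvd hi p hp.ne_one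
  have hn0 : 0 < n := Nat.pos_of_ne_zero (by rintro rfl; simp at hn)
  have her : e < r := (Nat.pow_lt_pow_iff_right hp.one_lt).1
    ((Nat.le_mul_of_pos_right _ hn0).trans_lt hir)
  obtain ⟨t, ht⟩ := WithTop.ne_top_iff_exists.1
    (v.ne_top_iff.2 (Nat.cast_ne_zero.2 hp.ne_zero : (p : L) ≠ 0))
  rw [← ht] at hvp
  have ht0 : 0 < t := by exact_mod_cast hvp
  have hn1 : v (n : L) = 0 :=
    v.natCast_eq_zero_of_coprime (by rw [← ht]; exact hvp) ((hp.coprime_iff_not_dvd).2 hn)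
  rw [Nat.cast_mul, v.map_mul, hn1, add_zero, Nat.cast_pow, Nat.cast_pow, v.map_pow, v.map_pow,
    ← ht, ← WithTop.coe_nsmul, ← WithTop.coe_nsmul, WithTop.coe_lt_coe, nsmul_eq_mul, nsmul_eq_mul]
  gcongr

open Polynomial in
/-- Points at least as far from the origin as every critical point, and outside the unit disc,
escape to infinity. -/
theorem AddValuation.eval_of_le_criticalPoints {L : Type*} [Field L] [CharZero L] [IsAlgClosed L]
    (v : AddValuation L (WithTop ℝ)) {p r : ℕ} (hp : p.Prime) (hvp : 0 < v (p : L)) {P : L[X]}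
    (hP : P.Monic) (hdeg : P.natDegree = p ^ r) (hP0 : P.coeff 0 = 0) {m : ℝ}
    (hm : ∀ c, P.derivative.eval c = 0 → (m : WithTop ℝ) ≤ v c) {t : ℝ} (htm : t ≤ m)
    {x : L} (hx : v x = t) : v (P.eval x) = ((p ^ r * t : ℝ) : WithTop ℝ) := by
  have hxpow : ∀ k : ℕ, v (x ^ k) = ((k * t : ℝ) : WithTop ℝ) := fun k => by
    rw [v.map_pow, hx, ← WithTop.coe_nsmul, nsmul_eq_mul]
  have heval : P.eval x =
      x ^ P.natDegree + ∑ i ∈ Finset.range P.natDegree, P.coeff i * x ^ i := by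
    conv_lhs => rw [hP.as_sum]
    simp [eval_finsetSum]
  have hlead : v (x ^ P.natDegree) = ((p ^ r * t : ℝ) : WithTop ℝ) := by
    rw [hxpow, hdeg]
    push_cast
    rfl
  rw [heval, v.map_add_eq_of_lt_left, hlead]
  rw [hlead]
  refine v.map_lt_sum WithTop.coe_ne_top fun i hi => ?_
  rw [Finset.mem_range] at hi
  by_cases hc : P.coeff i = 0
  · rw [hc, zero_mul, v.map_zero]
    exact WithTop.coe_lt_top _
  have hi0 : i ≠ 0 := by
    rintro rfl
    exact hc hP0
  have hbound := v.le_coeff_of_le_criticalPoints hP m hm (Nat.pos_of_ne_zero hi0) hi.le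
  have hlt := v.natCast_lt_of_lt_prime_pow hp hvp hi0 (hdeg ▸ hi)
  rw [v.map_mul, hxpow]
  obtain ⟨a, ha⟩ := WithTop.ne_top_iff_exists.1 (v.ne_top_iff.2 hc)
  obtain ⟨b, hb⟩ := WithTop.ne_top_iff_exists.1
    (v.ne_top_iff.2 (Nat.cast_ne_zero.2 hi0 : (i : L) ≠ 0))
  obtain ⟨d, hd⟩ := WithTop.ne_top_iff_exists.1
    (v.ne_top_iff.2 (Nat.cast_ne_zero.2 (pow_ne_zero r hp.ne_zero) : ((p ^ r : ℕ) : L) ≠ 0))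
  rw [hdeg, ← ha, ← hb, ← hd, ← WithTop.coe_add, ← WithTop.coe_add, WithTop.coe_le_coe] at hbound
  rw [← hb, ← hd, WithTop.coe_lt_coe] at hlt
  rw [← ha, ← WithTop.coe_add, WithTop.coe_lt_coe]
  push_cast at hbound
  have hir : (i : ℝ) < (p : ℝ) ^ r := by exact_mod_cast hdeg ▸ hi
  nlinarith [mul_le_mul_of_nonneg_left htm (sub_nonneg.2 hir.le)]

open Polynomial in
/-- Critical points with bounded orbits are integral. -/
theorem AddValuation.criticalPoint_nonneg {L : Type*} [Field L] [CharZero L] [IsAlgClosed L]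
    (v : AddValuation L (WithTop ℝ)) {p r : ℕ} (hp : p.Prime) (hr : 1 ≤ r) (hvp : 0 < v (p : L))
    {P : L[X]} (hP : P.Monic) (hdeg : P.natDegree = p ^ r) (hP0 : P.coeff 0 = 0)
    (hPCB : ∀ c, P.derivative.eval c = 0 →
      ∃ B : ℝ, ∀ n : ℕ, 1 ≤ n → (B : WithTop ℝ) ≤ v ((fun x => P.eval x)^[n] c))
    (c : L) (hc : P.derivative.eval c = 0) : 0 ≤ v c := by
  classical
  have hq : 1 < p ^ r := Nat.one_lt_pow (by omega) hp.one_lt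
  have hder : P.derivative ≠ 0 := by
    intro h
    have := derivative_eq_zero.1 h
    omega
  have hroot : ∀ {d : L}, P.derivative.eval d = 0 ↔ d ∈ P.derivative.roots.toFinset := by
    simp [hder]
  obtain ⟨d, hd, hmin⟩ := Finset.exists_min_image P.derivative.roots.toFinset v ⟨c, hroot.1 hc⟩
  refine le_trans ?_ (hmin c (hroot.1 hc))
  by_contra! hneg
  obtain ⟨m, hm⟩ := WithTop.ne_top_iff_exists.1 hneg.ne_top
  have hm0 : m < 0 := by
    rw [← hm] at hneg
    exact_mod_cast hneg
  have hq1 : (1 : ℝ) < (p : ℝ) ^ r := by exact_mod_cast hq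
  have horbit : ∀ n : ℕ, v ((fun x => P.eval x)^[n] d) =
      ((((p : ℝ) ^ r) ^ n * m : ℝ) : WithTop ℝ) := by
    intro n
    induction n with
    | zero => simp [hm]
    | succ n ih =>
      rw [Function.iterate_succ_apply', v.eval_of_le_criticalPoints hp hvp hP hdeg hP0
        (fun e he => hm ▸ hmin e (hroot.1 he)) ?_ ih, pow_succ]
      · congr 1
        ring
      · nlinarith [one_le_pow₀ hq1.le (n := n)]
  obtain ⟨B, hB⟩ := hPCB d (hroot.2 hd)
  obtain ⟨n, hn⟩ := pow_unbounded_of_one_lt (B / m) hq1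
  have hBn := hB (n + 1) (by omega)
  rw [horbit, WithTop.coe_le_coe] at hBn
  rw [div_lt_iff_of_neg hm0] at hn
  have : ((p : ℝ) ^ r) ^ n ≤ ((p : ℝ) ^ r) ^ (n + 1) := pow_le_pow_right₀ hq1.le (by omega)
  nlinarith

open Polynomial in
/-- Every polynomial of degree at least two over an algebraically closed field is linearly
conjugate to a monic polynomial fixing the origin. -/
theorem Polynomial.exists_monic_conjugate {L : Type*} [Field L] [IsAlgClosed L] {R : L[X]}
    (hR : 2 ≤ R.natDegree) :
    ∃ a b : L, a ≠ 0 ∧ (C a⁻¹ * (R.comp (C a * X + C b) - C b)).Monic ∧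
      (C a⁻¹ * (R.comp (C a * X + C b) - C b)).natDegree = R.natDegree ∧
      (C a⁻¹ * (R.comp (C a * X + C b) - C b)).coeff 0 = 0 := by
  have hlc : R.leadingCoeff ≠ 0 := by
    rw [Ne, leadingCoeff_eq_zero]
    rintro rfl
    simp at hR
  obtain ⟨a, ha⟩ := IsAlgClosed.exists_pow_nat_eq R.leadingCoeff⁻¹
    (show 0 < R.natDegree - 1 by omega)
  have ha0 : a ≠ 0 := by
    rintro rfl
    rw [zero_pow (by omega)] at ha
    exact inv_ne_zero hlc ha.symm
  have hfix : (R - X).natDegree = R.natDegree :=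
    natDegree_sub_eq_left_of_natDegree_lt (by rw [natDegree_X]; omega)
  obtain ⟨b, hb⟩ := IsAlgClosed.exists_root (R - X)
    (fun h => by have := natDegree_eq_zero_iff_degree_le_zero.2 h.le; omega)
  have hb' : R.eval b = b := by simpa [IsRoot, sub_eq_zero] using hb
  have hlin : (C a * X + C b).natDegree = 1 := natDegree_linear ha0
  have hcomp : (R.comp (C a * X + C b)).natDegree = R.natDegree := by
    rw [natDegree_comp, hlin, mul_one]
  have hsub : (R.comp (C a * X + C b) - C b).natDegree = R.natDegree := by
    rw [natDegree_sub_C, hcomp]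
  have hdeg : (C a⁻¹ * (R.comp (C a * X + C b) - C b)).natDegree = R.natDegree := by
    rw [natDegree_C_mul (inv_ne_zero ha0), hsub]
  refine ⟨a, b, ha0, ?_, hdeg, ?_⟩
  · have hpow : a ^ R.natDegree = a * a ^ (R.natDegree - 1) := by
      rw [← pow_succ', Nat.sub_add_cancel (by omega)]
    have hlead : (R.comp (C a * X + C b)).coeff R.natDegree =
        R.leadingCoeff * a ^ R.natDegree := by
      conv_lhs => rw [← hcomp]
      rw [coeff_natDegree, leadingCoeff_comp (by rw [hlin]; exact one_ne_zero),
        leadingCoeff_linear ha0]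
    rw [Monic, leadingCoeff, hdeg, coeff_C_mul, coeff_sub, hlead,
      coeff_C_of_ne_zero (by omega), sub_zero, hpow, ha]
    field_simp
  · simp [coeff_zero_eq_eval_zero, hb']

/-- A post-critically bounded polynomial of degree `q = p^r` has a linear conjugate
`P = ℓ⁻¹ ∘ R ∘ ℓ`, `ℓ(X) = aX + b`, which is monic, fixes `0`, and satisfies
`v(P_i) + v(i) ≥ v(q)` for all `1 ≤ i ≤ q`; in particular all coefficients of `P`
have nonnegative valuation. -/
theorem stmt_13 (p r : ℕ) (hp : p.Prime) (hr : 1 ≤ r) (q : ℕ) (hq : q = p ^ r)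
    (L : Type) [Field L] [CharZero L] [IsAlgClosed L]
    (v : L → WithTop ℝ)
    (hv0 : ∀ x : L, v x = ⊤ ↔ x = 0)
    (hvmul : ∀ x y : L, v (x * y) = v x + v y)
    (hvadd : ∀ x y : L, min (v x) (v y) ≤ v (x + y))
    (hvp : 0 < v ((p : L)))
    (R : Polynomial L) (hdeg : R.natDegree = q)
    -- `R` is post-critically bounded: every critical orbit has valuations bounded below
    (hPCB : ∀ c : L, R.derivative.eval c = 0 →
      ∃ B : ℝ, ∀ n : ℕ, 1 ≤ n → ((B : ℝ) : WithTop ℝ) ≤ v ((fun x => R.eval x)^[n] c)) :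
    ∃ a b : L, a ≠ 0 ∧
      ∃ P : Polynomial L,
        P = Polynomial.C a⁻¹ *
          (R.comp (Polynomial.C a * Polynomial.X + Polynomial.C b) - Polynomial.C b) ∧
        P.Monic ∧ P.coeff 0 = 0 ∧
        (∀ i : ℕ, 1 ≤ i → i ≤ q → v ((q : L)) ≤ v (P.coeff i) + v ((i : L))) ∧
        (∀ i : ℕ, 0 ≤ v (P.coeff i)) := by
  subst hq
  have hv1 : v 1 = 0 := by
    obtain ⟨t, ht⟩ := WithTop.ne_top_iff_exists.1 (mt (hv0 1).1 one_ne_zero)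
    have h := hvmul 1 1
    rw [mul_one, ← ht, ← WithTop.coe_add, WithTop.coe_inj] at h
    rw [← ht, show t = 0 by linarith, WithTop.coe_zero]
  let w : AddValuation L (WithTop ℝ) := AddValuation.of v ((hv0 0).2 rfl) hv1 hvadd hvmul
  have hwv : ∀ x, w x = v x := fun _ => rfl
  have hwp : 0 < w (p : L) := hvp
  have hq : 2 ≤ p ^ r := Nat.one_lt_pow (by omega) hp.one_lt
  obtain ⟨a, b, ha, hmonic, hPdeg, hP0⟩ :=
    Polynomial.exists_monic_conjugate (R := R) (by omega)
  refine ⟨a, b, ha, _, rfl, hmonic, hP0, ?_⟩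
  set P := Polynomial.C a⁻¹ *
    (R.comp (Polynomial.C a * Polynomial.X + Polynomial.C b) - Polynomial.C b) with hPdef
  rw [hdeg] at hPdeg
  have heval : ∀ x, P.eval x = a⁻¹ * (R.eval (a * x + b) - b) := fun x => by simp [hPdef]
  have hsemi : Function.Semiconj (fun x => a * x + b) (fun x => P.eval x) (fun x => R.eval x) :=
    fun x => by
      simp only [heval]
      field_simp
      ring
  have hPPCB : ∀ c, P.derivative.eval c = 0 →
      ∃ B : ℝ, ∀ n : ℕ, 1 ≤ n → (B : WithTop ℝ) ≤ w ((fun x => P.eval x)^[n] c) := by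
    intro c hc
    have hRc : R.derivative.eval (a * c + b) = 0 := by
      simpa [hPdef, Polynomial.derivative_comp, ha] using hc
    obtain ⟨B, hB⟩ := hPCB _ hRc
    obtain ⟨s, hs⟩ := WithTop.ne_top_iff_exists.1 (w.ne_top_iff.2 (inv_ne_zero ha))
    obtain ⟨β, hβB, hβb⟩ : ∃ β : ℝ, β ≤ B ∧ (β : WithTop ℝ) ≤ w b := by
      rcases eq_or_ne (w b) ⊤ with h | h
      · exact ⟨B, le_rfl, h ▸ le_top⟩
      · obtain ⟨t, ht⟩ := WithTop.ne_top_iff_exists.1 h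
        exact ⟨min B t, min_le_left _ _, ht ▸ WithTop.coe_le_coe.2 (min_le_right _ _)⟩
    refine ⟨s + β, fun n hn => ?_⟩
    have hn' : (fun x => P.eval x)^[n] c =
        a⁻¹ * ((fun x => R.eval x)^[n] (a * c + b) - b) := by
      have := (hsemi.iterate_right n).eq c
      rw [← this]
      field_simp
      ring
    rw [hn', w.map_mul, ← hs, WithTop.coe_add]
    gcongr
    exact w.map_le_sub ((WithTop.coe_le_coe.2 hβB).trans (hB n hn)) hβb
  have hcrit : ∀ c, P.derivative.eval c = 0 → ((0 : ℝ) : WithTop ℝ) ≤ w c :=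
    fun c hc => w.criticalPoint_nonneg hp hr hwp hmonic hPdeg hP0 hPPCB c hc
  have hbound : ∀ i : ℕ, 1 ≤ i → i ≤ p ^ r → w ((p ^ r : ℕ) : L) ≤ w (P.coeff i) + w (i : L) := by
    intro i hi hir
    have h := w.le_coeff_of_le_criticalPoints hmonic 0 hcrit hi (hPdeg ▸ hir)
    simpa [hPdeg] using h
  refine ⟨hbound, fun i => ?_⟩
  change 0 ≤ w (P.coeff i)
  rcases Nat.eq_zero_or_pos i with rfl | hi
  · simp [hP0]
  rcases lt_trichotomy i (p ^ r) with hlt | rfl | hgt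
  · have hle := (w.natCast_lt_of_lt_prime_pow hp hwp hi.ne' hlt).le.trans (hbound i hi hlt.le)
    obtain ⟨t, ht⟩ := WithTop.ne_top_iff_exists.1
      (w.ne_top_iff.2 (Nat.cast_ne_zero.2 hi.ne' : (i : L) ≠ 0))
    refine WithTop.le_of_add_le_add_right (ht ▸ WithTop.coe_ne_top : w (i : L) ≠ ⊤) ?_
    rwa [zero_add]
  · rw [← hPdeg, hmonic.coeff_natDegree, w.map_one]
  · simp [Polynomial.coeff_eq_zero_of_natDegree_lt (hPdeg ▸ hgt)]
end

section
/- Let P ∈ L[X] be monic of degree q = p^r with P(0) = 0. If there exists an index 1 ≤ i ≤ q with v(P_i) + v(i·1_L) < v(q·1_L) (equivalently, if P'(X)/q does not have all coefficients of nonnegative valuation), then there exists c ∈ L with P'(c) = 0 such that v(P^n(c)) → −∞ as n → ∞, where P^n denotes the n-th iterate of P under composition; in particular the forward orbit of the critical point c is unbounded. -/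
namespace AddValuation

open Polynomial

variable {L : Type*} [Field L] (v : AddValuation L (WithTop ℝ))

theorem map_natCast_nonneg (n : ℕ) : 0 ≤ v (n : L) := by
  induction n with
  | zero => simp
  | succ n ih =>
    rw [Nat.cast_succ]
    exact v.map_le_add ih v.map_one.ge

theorem map_intCast_nonneg (n : ℤ) : 0 ≤ v (n : L) := by
  obtain ⟨m, rfl | rfl⟩ := n.eq_nat_or_neg
  · simpa using v.map_natCast_nonneg m
  · simpa using v.map_natCast_nonneg m

/-- Among the positive integers up to `p ^ r`, the valuation is largest only at `p ^ r`. -/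
theorem map_natCast_lt_map_prime_pow [CharZero L] {p r i : ℕ} (hp : p.Prime)
    (hvp : 0 < v (p : L)) (hi : 1 ≤ i) (hir : i < p ^ r) :
    v (i : L) < v ((p ^ r : ℕ) : L) := by
  by_contra! h
  obtain ⟨a, har, ha⟩ := (Nat.dvd_prime_pow hp).1 (Nat.gcd_dvd_right i (p ^ r))
  have har' : a < r := by
    refine lt_of_le_of_ne har ?_
    rintro rfl
    have := Nat.le_of_dvd hi (ha ▸ Nat.gcd_dvd_left i (p ^ a))
    omega
  have hb : ((p ^ a : ℕ) : L) = (i : L) * (Nat.gcdA i (p ^ r) : L)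
      + ((p ^ r : ℕ) : L) * (Nat.gcdB i (p ^ r) : L) := by
    rw [← ha]
    exact_mod_cast congrArg (Int.cast : ℤ → L) (Nat.gcd_eq_gcd_ab i (p ^ r))
  have hle : v ((p ^ r : ℕ) : L) ≤ v ((p ^ a : ℕ) : L) := by
    rw [hb]
    refine v.map_le_add ?_ ?_
    · rw [v.map_mul]
      exact h.trans (le_add_of_nonneg_right (v.map_intCast_nonneg _))
    · rw [v.map_mul]
      exact le_add_of_nonneg_right (v.map_intCast_nonneg _)
  rw [Nat.cast_pow, Nat.cast_pow, v.map_pow, v.map_pow] at hle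
  obtain ⟨t, ht⟩ := WithTop.ne_top_iff_exists.1
    (v.ne_top_iff.2 (Nat.cast_ne_zero.2 hp.ne_zero : (p : L) ≠ 0))
  rw [← ht] at hle hvp
  have ht0 : 0 < t := by exact_mod_cast hvp
  rw [← WithTop.coe_nsmul, ← WithTop.coe_nsmul, WithTop.coe_le_coe, nsmul_eq_mul,
    nsmul_eq_mul] at hle
  have : (a : ℝ) < r := by exact_mod_cast har'
  nlinarith

/-- Lower bound for the valuations of the coefficients of a product of linear factors. -/
theorem le_map_coeff_prod_X_sub_C {ρ : ℝ} (s : Multiset L) (hs : ∀ a ∈ s, (ρ : WithTop ℝ) ≤ v a)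
    (k : ℕ) :
    ((((s.card : ℝ) - k) * ρ : ℝ) : WithTop ℝ) ≤ v ((s.map fun a => X - C a).prod.coeff k) := by
  induction s using Multiset.induction_on generalizing k with
  | empty =>
    rcases k with _ | k
    · simp
    · simp [coeff_one]
  | cons a s ih =>
    have ih' := ih fun b hb => hs b (Multiset.mem_cons_of_mem hb)
    have hmul : ∀ j : ℕ, ((ρ + ((s.card : ℝ) - j) * ρ : ℝ) : WithTop ℝ)
        ≤ v (a * (s.map fun a => X - C a).prod.coeff j) := fun j => by
      rw [v.map_mul, WithTop.coe_add]
      exact add_le_add (hs a (Multiset.mem_cons_self a s)) (ih' j)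
    rw [Multiset.map_cons, Multiset.prod_cons, Multiset.card_cons,
      sub_mul (X : L[X]), coeff_sub, coeff_C_mul]
    refine v.map_le_sub ?_ ?_
    · rcases k with _ | k
      · simp
      · rw [coeff_X_mul]
        convert ih' k using 2
        push_cast
        ring
    · convert hmul k using 2
      push_cast
      ring

theorem map_prod_sub_of_lt (s : Multiset L) (x : L) (hs : ∀ a ∈ s, v x < v a) :
    v ((s.map fun a => x - a).prod) = s.card • v x := by
  induction s using Multiset.induction_on with
  | empty => simp
  | cons a s ih =>
    rw [Multiset.map_cons, Multiset.prod_cons, v.map_mul, Multiset.card_cons, succ_nsmul',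
      ih fun b hb => hs b (Multiset.mem_cons_of_mem hb),
      v.map_sub_eq_of_lt_left (hs a (Multiset.mem_cons_self a s))]

/-- A point strictly larger than all roots of a monic polynomial, and than `1`, escapes. -/
theorem map_iterate_eval [IsAlgClosed L] {P : L[X]} (hP : P.Monic) (hdeg : 1 ≤ P.natDegree)
    {ρ t : ℝ} (hρ : ρ ≤ 0) (hroots : ∀ a ∈ P.roots, (ρ : WithTop ℝ) ≤ v a) (htρ : t < ρ) {c : L}
    (hc : v c = t) (n : ℕ) :
    v ((fun x => P.eval x)^[n] c) = (((P.natDegree : ℝ) ^ n * t : ℝ) : WithTop ℝ) := by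
  induction n with
  | zero => simp [hc]
  | succ n ih =>
    rw [Function.iterate_succ_apply']
    set y := (fun x => P.eval x)^[n] c
    have hlt : (P.natDegree : ℝ) ^ n * t < ρ := by
      have : (1 : ℝ) ≤ (P.natDegree : ℝ) ^ n := one_le_pow₀ (by exact_mod_cast hdeg)
      nlinarith
    have hsplit := IsAlgClosed.splits P
    have heval : P.eval y = (P.roots.map fun a => y - a).prod := by
      conv_lhs => rw [hsplit.eq_prod_roots_of_monic hP]
      rw [eval_multiset_prod, Multiset.map_map]
      simp
    have hcard : P.roots.card = P.natDegree := splits_iff_card_roots.1 hsplit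
    change v (P.eval y) = _
    rw [heval, v.map_prod_sub_of_lt, hcard, ih, ← WithTop.coe_nsmul, nsmul_eq_mul, pow_succ]
    · congr 1
      ring
    · intro a ha
      rw [ih]
      exact (WithTop.coe_lt_coe.2 hlt).trans_le (hroots a ha)

/-- Lower bound for the valuations of the coefficients of a monic polynomial all of whose critical
points have valuation at least `ρ`. -/
theorem le_map_coeff_of_critical [CharZero L] [IsAlgClosed L] {P : L[X]} (hP : P.Monic) {ρ : ℝ}
    (hcrit : ∀ c, P.derivative.eval c = 0 → (ρ : WithTop ℝ) ≤ v c) {i : ℕ} (hi : 1 ≤ i)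
    (hdeg : 1 ≤ P.natDegree) :
    v (P.natDegree : L) + ((((P.natDegree : ℝ) - i) * ρ : ℝ) : WithTop ℝ)
      ≤ v (P.coeff i) + v (i : L) := by
  obtain ⟨k, rfl⟩ := Nat.exists_eq_add_of_le' hi
  obtain ⟨m, hm⟩ := Nat.exists_eq_add_of_le' hdeg
  have hdd : P.derivative.natDegree = m := by
    rw [natDegree_derivative, hm, Nat.add_sub_cancel]
  have hlead : P.derivative.leadingCoeff = (P.natDegree : L) := by
    rw [leadingCoeff, hdd, coeff_derivative, ← hm, hP.coeff_natDegree, one_mul, hm]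
    push_cast
    rfl
  have hsplit := IsAlgClosed.splits P.derivative
  have hcard : P.derivative.roots.card = m := (splits_iff_card_roots.1 hsplit).trans hdd
  have hco : P.coeff (k + 1) * ((k + 1 : ℕ) : L) = (P.natDegree : L) *
      (P.derivative.roots.map fun a => X - C a).prod.coeff k := by
    rw [← hlead, ← coeff_C_mul, ← hsplit.eq_prod_roots, coeff_derivative]
    push_cast
    rfl
  have hbound := v.le_map_coeff_prod_X_sub_C P.derivative.roots
    (fun a ha => hcrit a (isRoot_of_mem_roots ha)) k
  rw [← v.map_mul, hco, v.map_mul]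
  refine add_le_add le_rfl ?_
  convert hbound using 3
  rw [hcard, hm]
  push_cast
  ring

/-- A monic polynomial with dominant leading term at `m` does not vanish there. -/
theorem eval_ne_zero_of_lt_map_coeff {P : L[X]} (hP : P.Monic) {ρ : ℝ} {m : L} (hm : v m = ρ)
    (h : ∀ i < P.natDegree, ((((P.natDegree : ℝ) - i) * ρ : ℝ) : WithTop ℝ) < v (P.coeff i)) :
    P.eval m ≠ 0 := by
  intro h0
  have hpow : ∀ n : ℕ, v (m ^ n) = ((n * ρ : ℝ) : WithTop ℝ) := fun n => by
    rw [v.map_pow, hm, ← WithTop.coe_nsmul, nsmul_eq_mul]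
  rw [eval_eq_sum_range, Finset.sum_range_succ, hP.coeff_natDegree, one_mul] at h0
  have hlt : ((P.natDegree * ρ : ℝ) : WithTop ℝ) <
      v (∑ i ∈ Finset.range P.natDegree, P.coeff i * m ^ i) := by
    refine v.map_lt_sum WithTop.coe_ne_top fun i hi => ?_
    rw [v.map_mul, hpow]
    have hsplit : (P.natDegree * ρ : ℝ) = ((P.natDegree : ℝ) - i) * ρ + i * ρ := by ring
    rw [hsplit, WithTop.coe_add]
    exact WithTop.add_lt_add_right WithTop.coe_ne_top (h i (Finset.mem_range.1 hi))
  rw [eq_neg_of_add_eq_zero_left h0, v.map_neg, hpow] at hlt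
  exact lt_irrefl _ hlt

end AddValuation

/-- If a monic degree-`q = p^r` polynomial `P` with `P(0) = 0` has some coefficient with
`v(P_i) + v(i) < v(q)`, then some critical point `c` of `P` has unbounded forward orbit:
`v(Pⁿ(c)) → -∞`. -/
theorem stmt_14 (p r : ℕ) (hp : p.Prime) (hr : 1 ≤ r) (q : ℕ) (hq : q = p ^ r)
    (L : Type) [Field L] [CharZero L] [IsAlgClosed L]
    (v : L → WithTop ℝ)
    (hv0 : ∀ x : L, v x = ⊤ ↔ x = 0)
    (hvmul : ∀ x y : L, v (x * y) = v x + v y)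
    (hvadd : ∀ x y : L, min (v x) (v y) ≤ v (x + y))
    (hvp : 0 < v ((p : L)))
    (P : Polynomial L) (hmonic : P.Monic) (hdeg : P.natDegree = q)
    (hP0 : P.coeff 0 = 0)
    (hbad : ∃ i : ℕ, 1 ≤ i ∧ i ≤ q ∧ v (P.coeff i) + v ((i : L)) < v ((q : L))) :
    ∃ c : L, P.derivative.eval c = 0 ∧
      ∀ B : ℝ, ∃ N : ℕ, ∀ n : ℕ, N ≤ n →
        v ((fun x => P.eval x)^[n] c) < ((B : ℝ) : WithTop ℝ) := by
  have hv1 : v 1 = 0 := by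
    obtain ⟨t, ht⟩ := WithTop.ne_top_iff_exists.1 (mt (hv0 1).1 one_ne_zero)
    have h := hvmul 1 1
    rw [mul_one, ← ht, ← WithTop.coe_add, WithTop.coe_inj] at h
    rw [← ht, show t = 0 by linarith, WithTop.coe_zero]
  obtain ⟨w, hw⟩ : ∃ w : AddValuation L (WithTop ℝ), ∀ x, w x = v x :=
    ⟨AddValuation.of v ((hv0 0).2 rfl) hv1 hvadd hvmul, fun _ => rfl⟩
  simp only [← hw] at hvp hbad hv1 ⊢
  have hq2 : 2 ≤ q := hq ▸ hp.two_le.trans (Nat.le_self_pow (by omega) p)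
  classical
  obtain ⟨m, hmem, hmin⟩ := Finset.exists_min_image (insert 1 P.roots.toFinset) w ⟨1, by simp⟩
  have hm0 : w m ≤ 0 := hv1 ▸ hmin 1 (by simp)
  obtain ⟨ρ, hmρ⟩ := WithTop.ne_top_iff_exists.1 (ne_top_of_le_ne_top WithTop.zero_ne_top hm0)
  rw [← hmρ] at hm0 hmin
  have hρ : ρ ≤ 0 := by exact_mod_cast hm0
  have hroots : ∀ a ∈ P.roots, (ρ : WithTop ℝ) ≤ w a := fun a ha =>
    hmin a (Finset.mem_insert_of_mem (Multiset.mem_toFinset.2 ha))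
  obtain ⟨c, hc, hcρ⟩ : ∃ c, P.derivative.eval c = 0 ∧ w c < ρ := by
    by_contra! hcrit
    have hcoeff := fun i (hi : 1 ≤ i) =>
      w.le_map_coeff_of_critical hmonic hcrit hi (by omega)
    rw [hdeg] at hcoeff
    rcases Finset.mem_insert.1 hmem with rfl | hmroot
    · rw [hv1] at hmρ
      have hρ0 : ρ = 0 := by exact_mod_cast hmρ
      obtain ⟨i, hi, -, hlt⟩ := hbad
      have := hcoeff i hi
      rw [hρ0, mul_zero, WithTop.coe_zero, add_zero] at this
      exact absurd hlt this.not_gt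
    · refine w.eval_ne_zero_of_lt_map_coeff hmonic hmρ.symm (fun i hi => ?_)
        (Polynomial.isRoot_of_mem_roots (Multiset.mem_toFinset.1 hmroot))
      rw [hdeg] at hi ⊢
      rcases Nat.eq_zero_or_pos i with rfl | hi0
      · rw [hP0, w.map_zero]
        exact WithTop.coe_lt_top _
      · have hlt : w (i : L) < w (q : L) := by
          subst hq
          exact w.map_natCast_lt_map_prime_pow hp hvp hi0 hi
        by_contra! hle
        refine absurd (hcoeff i hi0) (not_le_of_gt ?_)
        calc w (P.coeff i) + w (i : L)
            ≤ (((q : ℝ) - i) * ρ : ℝ) + w (i : L) := by gcongr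
          _ < (((q : ℝ) - i) * ρ : ℝ) + w (q : L) :=
              WithTop.add_lt_add_left WithTop.coe_ne_top hlt
          _ = _ := add_comm _ _
  obtain ⟨t, ht⟩ := WithTop.ne_top_iff_exists.1 hcρ.ne_top
  rw [← ht, WithTop.coe_lt_coe] at hcρ
  have ht0 : t < 0 := by linarith
  refine ⟨c, hc, fun B => ?_⟩
  obtain ⟨N, hN⟩ := exists_nat_gt (B / t)
  refine ⟨N, fun n hn => ?_⟩
  rw [w.map_iterate_eval hmonic (by omega) hρ hroots hcρ ht.symm, WithTop.coe_lt_coe, hdeg]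
  rw [div_lt_iff_of_neg ht0] at hN
  have hnq : (N : ℝ) ≤ (q : ℝ) ^ n := by
    exact_mod_cast hn.trans (Nat.lt_pow_self (by omega)).le
  nlinarith
end

section
/- Let d ≥ 1 be an integer with v(d·1_L) = 0, and suppose the polynomial X^d − 1 splits over L into d distinct linear factors. Let π, ρ ∈ L satisfy v(π) = v(ρ) > 0 and v(ρ − π) > v(π). Then v(ρ^d − π^d) = v(ρ − π) + (d − 1)·v(π). -/
section AdditiveValuation

variable {L : Type*} [Field L] {v : L → WithTop ℝ}

theorem valuation_one (hv0 : ∀ x : L, v x = ⊤ ↔ x = 0)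
    (hvmul : ∀ x y : L, v (x * y) = v x + v y) : v 1 = 0 := by
  have h := hvmul 1 1
  have h1 : v 1 ≠ ⊤ := fun h => one_ne_zero ((hv0 1).1 h)
  lift v 1 to ℝ using h1 with r hr
  rw [mul_one, ← hr] at h
  norm_cast at h ⊢
  linarith

theorem valuation_neg (hv0 : ∀ x : L, v x = ⊤ ↔ x = 0)
    (hvmul : ∀ x y : L, v (x * y) = v x + v y) (x : L) : v (-x) = v x := by
  have h := hvmul (-1) (-1)
  have h1 : v (-1) ≠ ⊤ := fun h => neg_ne_zero.2 one_ne_zero ((hv0 (-1)).1 h)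
  have h2 : v (-1) = 0 := by
    rw [neg_mul_neg, mul_one, valuation_one hv0 hvmul] at h
    lift v (-1) to ℝ using h1 with r hr
    norm_cast at h ⊢
    linarith
  rw [← neg_one_mul, hvmul, h2, zero_add]

theorem valuation_pow (hv0 : ∀ x : L, v x = ⊤ ↔ x = 0)
    (hvmul : ∀ x y : L, v (x * y) = v x + v y) (x : L) (n : ℕ) : v (x ^ n) = n • v x := by
  induction n with
  | zero => simp [valuation_one hv0 hvmul]
  | succ n ih => rw [pow_succ, hvmul, ih, succ_nsmul]

theorem valuation_natCast_nonneg (hv0 : ∀ x : L, v x = ⊤ ↔ x = 0)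
    (hvmul : ∀ x y : L, v (x * y) = v x + v y)
    (hvadd : ∀ x y : L, min (v x) (v y) ≤ v (x + y)) (n : ℕ) : 0 ≤ v (n : L) := by
  induction n with
  | zero => simp [(hv0 0).2 rfl]
  | succ n ih =>
    rw [Nat.cast_succ]
    exact (le_min ih (valuation_one hv0 hvmul).ge).trans (hvadd _ _)

/-- The binomial expansion of `(1 + e) ^ n` to second order, with integral remainder. -/
theorem exists_one_add_pow_sub_one_eq (hv0 : ∀ x : L, v x = ⊤ ↔ x = 0)
    (hvmul : ∀ x y : L, v (x * y) = v x + v y)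
    (hvadd : ∀ x y : L, min (v x) (v y) ≤ v (x + y)) {e : L} (he : 0 ≤ v e) (n : ℕ) :
    ∃ a, 0 ≤ v a ∧ (1 + e) ^ n - 1 = e * (n + e * a) := by
  induction n with
  | zero => exact ⟨0, by simp [(hv0 0).2 rfl], by simp⟩
  | succ n ih =>
    obtain ⟨a, ha, h⟩ := ih
    refine ⟨n + (a + e * a), ?_, ?_⟩
    · refine (le_min (valuation_natCast_nonneg hv0 hvmul hvadd n) ?_).trans (hvadd _ _)
      refine (le_min ha ?_).trans (hvadd _ _)
      rw [hvmul]
      exact add_nonneg he ha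
    · push_cast
      linear_combination (1 + e) * h

theorem valuation_add_eq_of_lt (hv0 : ∀ x : L, v x = ⊤ ↔ x = 0)
    (hvmul : ∀ x y : L, v (x * y) = v x + v y)
    (hvadd : ∀ x y : L, min (v x) (v y) ≤ v (x + y)) {x y : L} (h : v x < v y) :
    v (x + y) = v x := by
  apply le_antisymm
  · have h1 := hvadd (x + y) (-y)
    rw [add_neg_cancel_right, valuation_neg hv0 hvmul, min_le_iff] at h1
    exact h1.resolve_right h.not_ge
  · simpa [min_eq_left h.le] using hvadd x y

end AdditiveValuation


/-- If `v(d) = 0`, `X^d - 1` has `d` distinct roots in `L`, `v(π) = v(ρ) > 0` and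
`v(ρ - π) > v(π)`, then `v(ρ^d - π^d) = v(ρ - π) + (d - 1)·v(π)`. -/
theorem stmt_15 (L : Type) [Field L]
    (v : L → WithTop ℝ)
    (hv0 : ∀ x : L, v x = ⊤ ↔ x = 0)
    (hvmul : ∀ x y : L, v (x * y) = v x + v y)
    (hvadd : ∀ x y : L, min (v x) (v y) ≤ v (x + y))
    (d : ℕ) (hd : 1 ≤ d) (hvd : v ((d : L)) = 0)
    -- `X^d - 1` splits over `L` into `d` distinct linear factors
    (hroots : ∃ T : Finset L, T.card = d ∧ ∀ z ∈ T, z ^ d = 1)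
    (π ρ : L) (hvπρ : v π = v ρ) (hvπ : 0 < v π) (hdiff : v π < v (ρ - π)) :
    v (ρ ^ d - π ^ d) = v (ρ - π) + (d - 1) • v π := by
  have hπ : π ≠ 0 := fun h => hdiff.ne_top ((hv0 π).2 h)
  obtain ⟨e, he⟩ : ∃ e, ρ - π = π * e := ⟨(ρ - π) / π, by field_simp⟩
  have hve : 0 < v e := by
    by_contra! h
    rw [he, hvmul] at hdiff
    exact hdiff.not_ge (add_le_of_nonpos_right h)
  obtain ⟨a, ha, h⟩ := exists_one_add_pow_sub_one_eq hv0 hvmul hvadd hve.le d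
  have hunit : v ((d : L) + e * a) = 0 := by
    rw [valuation_add_eq_of_lt hv0 hvmul hvadd, hvd]
    rw [hvd, hvmul]
    exact add_pos_of_pos_of_nonneg hve ha
  have hfactor : ρ ^ d - π ^ d = (ρ - π) * π ^ (d - 1) * (d + e * a) := by
    obtain ⟨n, rfl⟩ := Nat.exists_eq_add_of_le' hd
    rw [he, show ρ = π * (1 + e) by linear_combination he, mul_pow, Nat.add_sub_cancel]
    linear_combination π ^ (n + 1) * h
  rw [hfactor, hvmul, hvmul, hunit, add_zero, valuation_pow hv0 hvmul]
end

section
/- Let p be a prime, r ≥ 2 an integer, q = p^r, and w > 0 a real number. Let r_2 and r' be integers with 1 ≤ r_2 and 1 ≤ r' ≤ r − 1, and let m_1, m_2, m' be real numbers satisfying m_1 ≥ r·w, m_1 − m_2 ≤ r_2·w, and m_1 − m' ≤ r'·w. Let A be a real number with |A| < ((p − 1)/2)·w. Then q·m'/(p^r − p^{r'}) > (m_1 − m_2)/(p^{r_2} − 1) + (2/(p − 1))·|A|. -/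
/-- Bernoulli's inequality in the form `n * (x - 1) ≤ x ^ n - 1`. -/
theorem natCast_mul_sub_one_le_pow_sub_one {x : ℝ} (hx : 1 ≤ x) (n : ℕ) :
    (n : ℝ) * (x - 1) ≤ x ^ n - 1 := by
  have h := one_add_mul_le_pow (a := x - 1) (by linarith) n
  rw [add_sub_cancel] at h
  linarith

theorem mul_pow_sub_one_le_natCast_mul_pow {x : ℝ} (hx : 2 ≤ x) {d : ℕ} (hd : 1 ≤ d) :
    x * (x ^ d - 1) ≤ (d : ℝ) * x ^ d * (x - 1) := by
  rcases hd.eq_or_lt with rfl | hd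
  · simp [mul_comm]
  · have hd' : (2 : ℝ) ≤ d := by exact_mod_cast hd
    have hpow : 0 < x ^ d := by positivity
    have h : x ≤ (d : ℝ) * (x - 1) := by nlinarith
    nlinarith [mul_le_mul_of_nonneg_right h hpow.le]

/-- The arithmetic inequality underlying the composition criterion for post-critically
bounded polynomials. -/
theorem stmt_16 (p : ℕ) (hp : p.Prime) (r : ℕ) (hr : 2 ≤ r) (q : ℕ) (hq : q = p ^ r)
    (w : ℝ) (hw : 0 < w)
    (r2 r' : ℕ) (hr2 : 1 ≤ r2) (hr'1 : 1 ≤ r') (hr'2 : r' ≤ r - 1)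
    (m1 m2 m' : ℝ) (hm1 : (r : ℝ) * w ≤ m1) (hm12 : m1 - m2 ≤ (r2 : ℝ) * w)
    (hm1' : m1 - m' ≤ (r' : ℝ) * w)
    (A : ℝ) (hA : |A| < ((p : ℝ) - 1) / 2 * w) :
    (m1 - m2) / ((p : ℝ) ^ r2 - 1) + 2 / ((p : ℝ) - 1) * |A| <
      (q : ℝ) * m' / ((p : ℝ) ^ r - (p : ℝ) ^ r') := by
  have hp2 : (2 : ℝ) ≤ p := by exact_mod_cast hp.two_le
  have hp1 : (0 : ℝ) < (p : ℝ) - 1 := by linarith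
  have hfirst : (m1 - m2) / ((p : ℝ) ^ r2 - 1) ≤ w / ((p : ℝ) - 1) := by
    have hpow : 0 < (p : ℝ) ^ r2 - 1 :=
      sub_pos.2 (one_lt_pow₀ (by linarith) (by omega))
    rw [div_le_div_iff₀ hpow hp1]
    calc (m1 - m2) * ((p : ℝ) - 1) ≤ (r2 : ℝ) * w * ((p : ℝ) - 1) := by gcongr
      _ = w * ((r2 : ℝ) * ((p : ℝ) - 1)) := by ring
      _ ≤ w * ((p : ℝ) ^ r2 - 1) := by
        gcongr
        exact natCast_mul_sub_one_le_pow_sub_one (by linarith) r2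
  have hsecond : 2 / ((p : ℝ) - 1) * |A| < w := by
    rw [div_mul_eq_mul_div, div_lt_iff₀ hp1]
    linarith
  obtain ⟨d, rfl⟩ : ∃ d, r = r' + d := ⟨r - r', by omega⟩
  have hd : 1 ≤ d := by omega
  have hm' : (d : ℝ) * w ≤ m' := by
    push_cast at hm1
    linarith
  have hthird : w / ((p : ℝ) - 1) + w ≤
      (q : ℝ) * m' / ((p : ℝ) ^ (r' + d) - (p : ℝ) ^ r') := by
    have hpow : 0 < (p : ℝ) ^ d - 1 :=
      sub_pos.2 (one_lt_pow₀ (by linarith) (by omega))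
    have hpr : (0 : ℝ) < (p : ℝ) ^ r' := by positivity
    have hq' : (q : ℝ) * m' / ((p : ℝ) ^ (r' + d) - (p : ℝ) ^ r') =
        (p : ℝ) ^ d * m' / ((p : ℝ) ^ d - 1) := by
      rw [hq, Nat.cast_pow, pow_add, ← mul_sub_one, mul_assoc,
        mul_div_mul_left _ _ hpr.ne']
    have hw' : w / ((p : ℝ) - 1) + w = w * p / ((p : ℝ) - 1) := by
      field_simp
      ring
    rw [hq', hw', div_le_div_iff₀ hp1 hpow]
    calc w * p * ((p : ℝ) ^ d - 1) = w * (p * ((p : ℝ) ^ d - 1)) := by ring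
      _ ≤ w * ((d : ℝ) * (p : ℝ) ^ d * ((p : ℝ) - 1)) := by
        gcongr w * ?_
        exact mul_pow_sub_one_le_natCast_mul_pow hp2 hd
      _ = (p : ℝ) ^ d * ((d : ℝ) * w) * ((p : ℝ) - 1) := by ring
      _ ≤ (p : ℝ) ^ d * m' * ((p : ℝ) - 1) := by gcongr
  linarith
end

section
/- Let p be a prime, r ≥ 2 an integer, q = p^r, and n ≥ 2 an integer. Let t, t', v_0 be real numbers with v_0 ≠ 0, let e, e_1, e_2 be integers with 0 ≤ e, e_1, e_2 ≤ q − 1, and let r', r_2 be integers with 1 ≤ r' ≤ r − 1 and 1 ≤ r_2 ≤ r. Define s = t + (e/(q − p^{r'}))·(v_0/q^n) and s' = t' + ((e_1 − e_2)/(p^{r_2} − 1))·(v_0/q^{n−1}). If q·t > t' + (2/(p − 1))·|v_0|, then q·s > s'. -/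
/-- The arithmetic core of the criterion guaranteeing that consecutive intermediate
Hasse-Herbrand functions compose well. -/
theorem stmt_17 (p : ℕ) (hp : p.Prime) (r : ℕ) (hr : 2 ≤ r) (q : ℕ) (hq : q = p ^ r)
    (n : ℕ) (hn : 2 ≤ n)
    (t t' v0 : ℝ) (hv0 : v0 ≠ 0)
    (e e1 e2 : ℕ) (he : e ≤ q - 1) (he1 : e1 ≤ q - 1) (he2 : e2 ≤ q - 1)
    (r' r2 : ℕ) (hr'1 : 1 ≤ r') (hr' : r' ≤ r - 1) (hr21 : 1 ≤ r2) (hr2 : r2 ≤ r)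
    (s s' : ℝ)
    (hs : s = t + (e : ℝ) / ((q : ℝ) - (p : ℝ) ^ r') * (v0 / (q : ℝ) ^ n))
    (hs' : s' = t' + ((e1 : ℝ) - (e2 : ℝ)) / ((p : ℝ) ^ r2 - 1) * (v0 / (q : ℝ) ^ (n - 1)))
    (h : (q : ℝ) * t > t' + 2 / ((p : ℝ) - 1) * |v0|) :
    (q : ℝ) * s > s' := by
  have hp2 : (2 : ℝ) ≤ p := by exact_mod_cast hp.two_le
  have hp0 : (0 : ℝ) < (p : ℝ) - 1 := by linarith
  have hqR : (q : ℝ) = (p : ℝ) ^ r := by rw [hq]; push_cast; rfl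
  have hq1 : (1 : ℝ) ≤ q := by rw [hqR]; exact one_le_pow₀ (by linarith)
  have hQq : (q : ℝ) ≤ (q : ℝ) ^ (n - 1) := le_self_pow₀ hq1 (by omega)
  have hqn : (q : ℝ) ^ n = q * (q : ℝ) ^ (n - 1) := by
    rw [← pow_succ', Nat.sub_add_cancel (by omega)]
  set Q : ℝ := (q : ℝ) ^ (n - 1)
  have hQ : 0 < Q := by linarith
  have hd1 : (p : ℝ) - 1 ≤ q - (p : ℝ) ^ r' := by
    have h1 : (p : ℝ) ^ r' ≤ (p : ℝ) ^ (r - 1) := pow_le_pow_right₀ (by linarith) hr'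
    have h2 : (p : ℝ) ^ r = (p : ℝ) ^ (r - 1) * p := by
      rw [← pow_succ, Nat.sub_add_cancel (by omega)]
    have h3 : (1 : ℝ) ≤ (p : ℝ) ^ (r - 1) := one_le_pow₀ (by linarith)
    rw [hqR, h2]
    nlinarith
  have hd2 : (p : ℝ) - 1 ≤ (p : ℝ) ^ r2 - 1 := by
    have : (p : ℝ) ≤ (p : ℝ) ^ r2 := le_self_pow₀ (by linarith) (by omega)
    linarith
  have le_Q {k : ℕ} (hk : k ≤ q - 1) : (k : ℝ) ≤ Q := by
    have : (k : ℝ) ≤ q := by exact_mod_cast hk.trans (Nat.sub_le q 1)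
    linarith
  have hA : |(e : ℝ) / ((q : ℝ) - (p : ℝ) ^ r')| ≤ Q / ((p : ℝ) - 1) := by
    rw [abs_div, Nat.abs_cast, abs_of_pos (hp0.trans_le hd1)]
    exact div_le_div₀ hQ.le (le_Q he) hp0 hd1
  have hB : |((e1 : ℝ) - e2) / ((p : ℝ) ^ r2 - 1)| ≤ Q / ((p : ℝ) - 1) := by
    rw [abs_div, abs_of_pos (hp0.trans_le hd2)]
    exact div_le_div₀ hQ.le
      (abs_sub_le_of_nonneg_of_le e1.cast_nonneg (le_Q he1) e2.cast_nonneg (le_Q he2)) hp0 hd2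
  have hq_mul : (q : ℝ) * s =
      q * t + (e : ℝ) / ((q : ℝ) - (p : ℝ) ^ r') * (v0 / Q) := by
    rw [hs, hqn, mul_add, ← div_div, div_right_comm, mul_left_comm,
      mul_div_cancel₀ _ (by linarith : (q : ℝ) ≠ 0)]
  rw [hq_mul, hs']
  generalize (e : ℝ) / ((q : ℝ) - (p : ℝ) ^ r') = A at hA ⊢
  generalize ((e1 : ℝ) - e2) / ((p : ℝ) ^ r2 - 1) = B at hB ⊢
  have hAB : |(B - A) * (v0 / Q)| ≤ 2 / ((p : ℝ) - 1) * |v0| := by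
    calc |(B - A) * (v0 / Q)| = |B - A| * (|v0| / Q) := by
          rw [abs_mul, abs_div, abs_of_pos hQ]
      _ ≤ (Q / ((p : ℝ) - 1) + Q / ((p : ℝ) - 1)) * (|v0| / Q) := by
          gcongr
          exact (abs_sub B A).trans (add_le_add hB hA)
      _ = 2 / ((p : ℝ) - 1) * |v0| := by
          field_simp
          ring
  linarith [(le_abs_self _).trans hAB, sub_mul B A (v0 / Q)]
end
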